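/- arXiv:1202.0050 — 8 statements merged into one kernel-verified Lean document; each statement's English description precedes it below -/
import Mathlib

section
/- There is an absolute constant C such that the following holds. Let E : [0,∞) → ℂ be continuous, compactly supported, twice continuously differentiable on (0,∞), with E' integrable on (0,1) and with the three quantities on the right-hand side below finite. Then for every t > 2, | ∫₀^∞ e^{itλ²} λ E(λ) dλ − i E(0)/(2t) | ≤ C [ (1/t) ∫₀^{t^{-1/2}} |E'(λ)| dλ + (1/t^{3/2}) |E'(t^{-1/2})| + (1/t²) ∫_{t^{-1/2}}^∞ | (E'(λ)/λ)' | dλ ]. -/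
open MeasureTheory Set

noncomputable section

/-- Lemma 4.2 of the paper: integration by parts estimate for the
oscillatory integral `∫₀^∞ e^{itλ²} λ E(λ) dλ`. -/
theorem stmt0 :
    ∃ C : ℝ, 0 < C ∧ ∀ (E : ℝ → ℂ),
      ContinuousOn E (Ici 0) →
      HasCompactSupport E →
      ContDiffOn ℝ 2 E (Ioi 0) →
      IntegrableOn (deriv E) (Ioo 0 1) →
      ∀ t : ℝ, 2 < t →
      IntegrableOn (deriv E) (Ioo 0 (t ^ (-(1/2) : ℝ))) →
      IntegrableOn (deriv fun s : ℝ => deriv E s / (s : ℂ)) (Ioi (t ^ (-(1/2) : ℝ))) →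
      ‖(∫ l in Ioi (0:ℝ), Complex.exp (Complex.I * (t:ℂ) * (l:ℂ) ^ 2) * (l:ℂ) * E l)
          - Complex.I * E 0 / (2 * (t:ℂ))‖
        ≤ C * ((1 / t) * (∫ l in Ioo (0:ℝ) (t ^ (-(1/2) : ℝ)), ‖deriv E l‖)
            + (1 / t ^ ((3:ℝ)/2)) * ‖deriv E (t ^ (-(1/2) : ℝ))‖
            + (1 / t ^ 2) * ∫ l in Ioi (t ^ (-(1/2) : ℝ)),
                ‖deriv (fun s : ℝ => deriv E s / (s : ℂ)) l‖) := by
  refine ⟨1, one_pos, ?_⟩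
  intro E hc hcs hE _ t ht hint hint2
  have ht0 : (0:ℝ) < t := by linarith
  have ha3 : 1 / t ^ ((3:ℝ)/2) = (t ^ (-(1/2) : ℝ)) ^ 3 := by
    rw [← Real.rpow_natCast, ← Real.rpow_mul ht0.le, one_div, ← Real.rpow_neg ht0.le]
    norm_num
  have ha2 : 1 / t = (t ^ (-(1/2) : ℝ)) ^ 2 := by
    rw [← Real.rpow_natCast, ← Real.rpow_mul ht0.le, one_div, ← Real.rpow_neg_one]
    norm_num
  have ha0 : 0 < t ^ (-(1/2) : ℝ) := Real.rpow_pos_of_pos ht0 _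
  have ha1 : t ^ (-(1/2) : ℝ) < 1 := Real.rpow_lt_one_of_one_lt_of_neg (by linarith) (by norm_num)
  rw [ha3]
  generalize t ^ (-(1/2) : ℝ) = a at *
  obtain ⟨R, hR1, hR⟩ : ∃ R : ℝ, 1 < R ∧ ∀ x, R - 1 < x → E x = 0 := by
    obtain ⟨r, hr⟩ := hcs.isCompact.isBounded.subset_closedBall 0
    refine ⟨max r 1 + 1, by linarith [le_max_right r 1], fun x hx => ?_⟩
    by_contra h
    have := hr (subset_tsupport E h)
    rw [Metric.mem_closedBall, dist_zero_right, Real.norm_eq_abs] at this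
    linarith [le_max_left r 1, le_abs_self x]
  have hER : E R = 0 := hR R (by linarith)
  have hdER : deriv E R = 0 := by
    have : E =ᶠ[nhds R] fun _ => 0 := by
      filter_upwards [Ioi_mem_nhds (show R - 1 < R by linarith)] with x hx using hR x hx
    rw [this.deriv_eq, deriv_const]
  have haR : a ≤ R := by linarith
  have htc : (t:ℂ) ≠ 0 := by exact_mod_cast ht0.ne'
  have hIne := Complex.I_ne_zero
  have hEd : ∀ x, 0 < x → HasDerivAt E (deriv E x) x := fun x hx =>
    ((hE.differentiableOn (by norm_num)).differentiableAt (Ioi_mem_nhds hx)).hasDerivAt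
  have hdE : ContDiffOn ℝ 1 (deriv E) (Ioi 0) := hE.deriv_of_isOpen isOpen_Ioi (by norm_num)
  have hdEd : ∀ x, 0 < x → DifferentiableAt ℝ (deriv E) x := fun x hx =>
    (hdE.differentiableOn (by norm_num)).differentiableAt (Ioi_mem_nhds hx)
  set g : ℝ → ℂ := fun s : ℝ => deriv E s / (s : ℂ) with hg
  have hgd : ∀ x, 0 < x → HasDerivAt g (deriv g x) x := fun x hx => by
    have h1 : DifferentiableAt ℝ (fun s : ℝ => (s:ℂ)) x := Complex.ofRealCLM.differentiableAt
    exact ((hdEd x hx).div h1 (by exact_mod_cast hx.ne')).hasDerivAt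
  set e : ℝ → ℂ := fun l => Complex.exp (Complex.I * (t:ℂ) * (l:ℂ) ^ 2) with he
  have hen : ∀ l, ‖e l‖ = 1 := fun l => by
    have : Complex.I * (t:ℂ) * (l:ℂ) ^ 2 = ((t * l ^ 2 : ℝ) : ℂ) * Complex.I := by
      push_cast; ring
    simp only [he]
    rw [this, Complex.norm_exp_ofReal_mul_I]
  have hed : ∀ l, HasDerivAt e (2 * Complex.I * t * l * e l) l := fun l => by
    have h1 : HasDerivAt (fun s : ℝ => (s:ℂ)) 1 l := Complex.ofRealCLM.hasDerivAt
    have h2 := ((h1.pow 2).const_mul (Complex.I * (t:ℂ))).cexp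
    refine HasDerivAt.congr_deriv (f := e) h2 ?_
    change e l * (Complex.I * t * ((2:ℕ) * (l:ℂ) ^ (2 - 1) * 1)) = 2 * Complex.I * t * l * e l
    push_cast; ring
  have hec : Continuous e := by simp only [he]; fun_prop
  -- integrability
  have hdEc : ContinuousOn (deriv E) (uIcc a R) := by
    rw [uIcc_of_le haR]
    exact hdE.continuousOn.mono fun x hx => lt_of_lt_of_le ha0 hx.1
  have i1 : IntervalIntegrable (deriv E) volume 0 a := by
    rw [intervalIntegrable_iff_integrableOn_Ioo_of_le ha0.le]; exact hint
  have i2 : IntervalIntegrable (deriv E) volume a R := hdEc.intervalIntegrable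
  have i3 : IntervalIntegrable (deriv g) volume a R := by
    rw [intervalIntegrable_iff_integrableOn_Ioc_of_le haR]
    exact hint2.mono_set Ioc_subset_Ioi_self
  have j1 := i1.continuousOn_mul (g := e) hec.continuousOn
  have j2 := i2.continuousOn_mul (g := e) hec.continuousOn
  have j3 := i3.continuousOn_mul (g := e) hec.continuousOn
  have hcR : ContinuousOn E (Icc 0 R) := hc.mono Icc_subset_Ici_self
  have j0 : IntervalIntegrable (fun l : ℝ => e l * l * E l) volume 0 R := by
    apply ContinuousOn.intervalIntegrable
    rw [uIcc_of_le (by linarith)]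
    exact ((hec.mul Complex.continuous_ofReal).continuousOn).mul hcR
  -- first integration by parts
  have p1 : (∫ l in (0:ℝ)..R, (e l * l * E l + (1 / (2 * Complex.I * t)) * (e l * deriv E l)))
      = (1 / (2 * Complex.I * t)) * (e R * E R) - (1 / (2 * Complex.I * t)) * (e 0 * E 0) := by
    refine intervalIntegral.integral_eq_sub_of_hasDerivAt_of_le (by linarith)
      (f := fun l => (1 / (2 * Complex.I * t)) * (e l * E l)) ?_ ?_ ?_
    · exact continuousOn_const.mul (hec.continuousOn.mul hcR)
    · intro x hx
      refine (((hed x).mul (hEd x hx.1)).const_mul (1 / (2 * Complex.I * t))).congr_deriv ?_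
      field_simp
    · exact j0.add ((j1.trans j2).const_mul _)
  rw [intervalIntegral.integral_add j0 ((j1.trans j2).const_mul _),
    intervalIntegral.integral_const_mul,
    ← intervalIntegral.integral_add_adjacent_intervals j1 j2, hER] at p1
  have p2 : (∫ l in a..R, (e l * deriv E l + (1 / (2 * Complex.I * t)) * (e l * deriv g l)))
      = (1 / (2 * Complex.I * t)) * (e R * g R) - (1 / (2 * Complex.I * t)) * (e a * g a) := by
    refine intervalIntegral.integral_eq_sub_of_hasDerivAt_of_le haR
      (f := fun l => (1 / (2 * Complex.I * t)) * (e l * g l)) ?_ ?_ ?_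
    · refine continuousOn_const.mul (hec.continuousOn.mul ?_)
      intro x hx
      exact (hgd x (ha0.trans_le hx.1)).continuousAt.continuousWithinAt
    · intro x hx
      have hx0 : (x:ℂ) ≠ 0 := by exact_mod_cast (ha0.trans hx.1).ne'
      refine (((hed x).mul (hgd x (ha0.trans hx.1))).const_mul
        (1 / (2 * Complex.I * t))).congr_deriv ?_
      have : deriv E x = x * g x := by simp only [hg]; field_simp
      rw [this]
      field_simp
    · exact j2.add (j3.const_mul _)
  rw [intervalIntegral.integral_add j2 (j3.const_mul _),
    intervalIntegral.integral_const_mul] at p2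
  have hgR : g R = 0 := by simp [hg, hdER]
  rw [hgR] at p2
  have he0 : e 0 = 1 := by simp [he]
  rw [he0] at p1
  have hI : (∫ l in Ioi (0:ℝ), e l * (l:ℂ) * E l) = ∫ l in (0:ℝ)..R, e l * l * E l := by
    rw [intervalIntegral.integral_of_le (by linarith)]
    refine setIntegral_eq_of_subset_of_forall_sdiff_eq_zero measurableSet_Ioi
      Ioc_subset_Ioi_self ?_
    intro x hx
    have : R < x := by
      by_contra h
      exact hx.2 ⟨hx.1, not_lt.1 h⟩
    rw [hR x (by linarith), mul_zero]
  change ‖(∫ l in Ioi (0:ℝ), e l * (l:ℂ) * E l) - _‖ ≤ _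
  rw [hI]
  have b1 : ‖∫ l in (0:ℝ)..a, e l * deriv E l‖ ≤ ∫ l in Ioo (0:ℝ) a, ‖deriv E l‖ := by
    refine (intervalIntegral.norm_integral_le_integral_norm ha0.le).trans_eq ?_
    rw [intervalIntegral.integral_of_le ha0.le, integral_Ioc_eq_integral_Ioo]
    simp [hen]
  have b3 : ‖∫ l in a..R, e l * deriv g l‖ ≤ ∫ l in Ioi a, ‖deriv g l‖ := by
    refine (intervalIntegral.norm_integral_le_integral_norm haR).trans ?_
    rw [intervalIntegral.integral_of_le haR]
    simp only [norm_mul, hen, one_mul]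
    exact setIntegral_mono_set hint2.norm (Filter.Eventually.of_forall fun _ => norm_nonneg _)
      (Filter.Eventually.of_forall Ioc_subset_Ioi_self)
  have b2 : ‖g a‖ = ‖deriv E a‖ / a := by
    simp [hg, abs_of_pos ha0]
  have key : (∫ l in (0:ℝ)..R, e l * l * E l) - Complex.I * E 0 / (2 * (t:ℂ))
      = -(1 / (2 * Complex.I * t)) * (∫ l in (0:ℝ)..a, e l * deriv E l)
        + (1 / (2 * Complex.I * t)) ^ 2 * (e a * g a)
        + (1 / (2 * Complex.I * t)) ^ 2 * (∫ l in a..R, e l * deriv g l) := by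
    have h0 : Complex.I * E 0 / (2 * (t:ℂ)) = -((1 / (2 * Complex.I * t)) * E 0) := by
      field_simp
      rw [Complex.I_sq]; ring
    rw [h0]
    linear_combination p1 - (1 / (2 * Complex.I * t)) * p2
  have hk : ‖(1 / (2 * Complex.I * t) : ℂ)‖ = a ^ 2 / 2 := by
    rw [← ha2]
    simp [abs_of_pos ht0]
    ring
  have ha4 : 1 / t ^ 2 = a ^ 4 := by
    rw [show a ^ 4 = (a ^ 2) ^ 2 by ring, ← ha2]; ring
  rw [key, ha2, ha4]
  refine norm_add₃_le.trans ?_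
  simp only [norm_mul, norm_neg, norm_pow, hk, hen, b2, one_mul]
  have n1 := (norm_nonneg _).trans b1
  have n3 := (norm_nonneg _).trans b3
  have e2 : (a ^ 2 / 2) ^ 2 * (‖deriv E a‖ / a) = a ^ 3 * ‖deriv E a‖ / 4 := by
    field_simp; ring
  rw [e2]
  have n2 : 0 ≤ a ^ 3 * ‖deriv E a‖ := by positivity
  have c1 := mul_le_mul_of_nonneg_left b1 (show 0 ≤ a ^ 2 by positivity)
  have c3 := mul_le_mul_of_nonneg_left b3 (show 0 ≤ a ^ 4 by positivity)
  have d1 := mul_nonneg (show 0 ≤ a ^ 2 by positivity) n1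
  have d3 := mul_nonneg (show 0 ≤ a ^ 4 by positivity) n3
  nlinarith [c1, c3, d1, d3, n2]
end
end

section
/- There is an absolute constant C such that the following holds. Let E : [0,∞) → ℂ be continuous, compactly supported, continuously differentiable on (0,∞), with E(0) = 0 and with the two integrals on the right-hand side below finite. Then for every t > 2, | ∫₀^∞ e^{itλ²} λ E(λ) dλ | ≤ C [ (1/t) ∫₀^∞ |E'(λ)| / (1 + λ² t) dλ + (1/t) ∫_{t^{-1/2}}^∞ | E'(√(λ² + π/t)) − E'(λ) | dλ ]. -/
open MeasureTheory Set

noncomputable section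

lemma aux_phase_norm (t l : ℝ) : ‖Complex.exp (Complex.I * (t:ℂ) * (l:ℂ) ^ 2)‖ = 1 := by
  have : Complex.I * (t:ℂ) * (l:ℂ) ^ 2 = ((t * l ^ 2 : ℝ) : ℂ) * Complex.I := by
    push_cast; ring
  rw [this, Complex.norm_exp_ofReal_mul_I]

lemma aux_phase_shift (t l : ℝ) (ht : 0 < t) :
    Complex.exp (Complex.I * (t:ℂ) * ((Real.sqrt (l ^ 2 + Real.pi / t) : ℝ) : ℂ) ^ 2)
      = - Complex.exp (Complex.I * (t:ℂ) * (l:ℂ) ^ 2) := by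
  have h0 : 0 ≤ l ^ 2 + Real.pi / t := by positivity
  have h1 : ((Real.sqrt (l ^ 2 + Real.pi / t) : ℝ) : ℂ) ^ 2 = (l:ℂ) ^ 2 + Real.pi / t := by
    rw [← Complex.ofReal_pow, Real.sq_sqrt h0]; push_cast; ring
  have htc : (t : ℂ) ≠ 0 := by exact_mod_cast ht.ne'
  have h2 : Complex.I * (t:ℂ) * ((l:ℂ) ^ 2 + Real.pi / t)
      = Complex.I * (t:ℂ) * (l:ℂ) ^ 2 + Real.pi * Complex.I := by
    field_simp
  rw [h1, h2, Complex.exp_add, Complex.exp_pi_mul_I]; ring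

lemma aux_image (c a : ℝ) (hc : 0 < c) (ha : 0 < a) :
    (fun l : ℝ => Real.sqrt (l ^ 2 + c)) '' Ioi a = Ioi (Real.sqrt (a ^ 2 + c)) := by
  ext y
  simp only [mem_image, mem_Ioi]
  constructor
  · rintro ⟨x, hx, rfl⟩
    apply Real.sqrt_lt_sqrt (by positivity)
    nlinarith
  · intro hy
    have hy0 : 0 < y := lt_of_le_of_lt (Real.sqrt_nonneg _) hy
    have h1 : a ^ 2 + c < y ^ 2 := (Real.sqrt_lt' hy0).1 hy
    refine ⟨Real.sqrt (y ^ 2 - c), ?_, ?_⟩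
    · apply Real.lt_sqrt_of_sq_lt; linarith
    · rw [Real.sq_sqrt (by nlinarith)]
      rw [sub_add_cancel, Real.sqrt_sq hy0.le]

lemma aux_inj (c a : ℝ) (hc : 0 < c) (ha : 0 < a) :
    InjOn (fun l : ℝ => Real.sqrt (l ^ 2 + c)) (Ioi a) := by
  intro x hx y hy h
  simp only [mem_Ioi] at hx hy
  have h := (Real.sqrt_inj (by positivity) (by positivity)).1 h
  have : x ^ 2 = y ^ 2 := by linarith
  exact (pow_left_inj₀ (by linarith) (by linarith) two_ne_zero).1 this

lemma aux_deriv (c x : ℝ) (hc : 0 < c) :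
    HasDerivAt (fun l : ℝ => Real.sqrt (l ^ 2 + c)) (x / Real.sqrt (x ^ 2 + c)) x := by
  have h := ((hasDerivAt_pow 2 x).add_const c).sqrt (by positivity)
  convert h using 1
  have : Real.sqrt (x ^ 2 + c) ≠ 0 := by positivity
  field_simp
  norm_num
  try ring

lemma aux_w (c x : ℝ) (hc : 0 < c) (hx : 0 < x) :
    0 ≤ x / Real.sqrt (x ^ 2 + c) ∧ x / Real.sqrt (x ^ 2 + c) ≤ 1 ∧
      1 - x / Real.sqrt (x ^ 2 + c) ≤ c / x ^ 2 := by
  have hs : 0 < Real.sqrt (x ^ 2 + c) := by positivity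
  have hss : Real.sqrt (x ^ 2 + c) ^ 2 = x ^ 2 + c := Real.sq_sqrt (by positivity)
  generalize Real.sqrt (x ^ 2 + c) = s at *
  have hxs : x ≤ s := by nlinarith
  refine ⟨by positivity, (div_le_one hs).2 hxs, ?_⟩
  have hc' : c = s ^ 2 - x ^ 2 := by linarith
  rw [one_sub_div hs.ne', div_le_div_iff₀ hs (by positivity), hc']
  have h1 : 0 ≤ s - x := by linarith
  have h2 : x ^ 2 ≤ (s + x) * s := by nlinarith
  nlinarith [mul_le_mul_of_nonneg_left h2 h1]

lemma aux_osc (D : ℝ → ℂ) (t : ℝ) (ht : 0 < t) (hD : IntegrableOn D (Ioi 0))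
    (hA : IntegrableOn (fun l : ℝ => ‖D l‖ / (1 + l ^ 2 * t)) (Ioi 0))
    (a : ℝ) (ha : 0 < a) (hat : a ^ 2 * t = 1)
    (hB : IntegrableOn (fun l : ℝ => ‖D (Real.sqrt (l ^ 2 + Real.pi / t)) - D l‖) (Ioi a)) :
    ‖∫ l in Ioi (0:ℝ), Complex.exp (Complex.I * (t:ℂ) * (l:ℂ) ^ 2) * D l‖
      ≤ 16 * ((∫ l in Ioi (0:ℝ), ‖D l‖ / (1 + l ^ 2 * t)) +
        ∫ l in Ioi a, ‖D (Real.sqrt (l ^ 2 + Real.pi / t)) - D l‖) := by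
  set c := Real.pi / t with hc
  have hc0 : 0 < c := by positivity
  set σ : ℝ → ℝ := fun l => Real.sqrt (l ^ 2 + c) with hσ
  set e : ℝ → ℂ := fun l => Complex.exp (Complex.I * (t:ℂ) * (l:ℂ) ^ 2) with he
  set w : ℝ → ℝ := fun l => l / σ l with hw
  set b := σ a with hb
  set A := ∫ l in Ioi (0:ℝ), ‖D l‖ / (1 + l ^ 2 * t) with hAd
  set B := ∫ l in Ioi a, ‖D (σ l) - D l‖ with hBd
  have hen : ∀ l, ‖e l‖ = 1 := aux_phase_norm t
  have hecont : Continuous e := by simp only [he]; fun_prop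
  have hab : a ≤ b := by
    apply Real.le_sqrt_of_sq_le; linarith
  have hb2 : b ^ 2 * t = 1 + Real.pi := by
    have : b ^ 2 = a ^ 2 + c := Real.sq_sqrt (by positivity)
    rw [this, add_mul, hat, hc]; field_simp
  have hb0 : 0 < b := lt_of_lt_of_le ha hab
  have hpi3 := Real.pi_gt_three
  have hpi4 := Real.pi_lt_four
  have heD : IntegrableOn (fun l => e l * D l) (Ioi 0) := by
    refine Integrable.mono hD (hecont.aestronglyMeasurable.mul hD.aestronglyMeasurable) ?_
    filter_upwards with l
    rw [norm_mul, hen, one_mul]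
  have hAnn : ∀ l, 0 ≤ ‖D l‖ / (1 + l ^ 2 * t) := fun l => by positivity
  -- change of variables
  have hcv : ∫ l in Ioi b, e l * D l = - ∫ l in Ioi a, (w l : ℂ) * (e l * D (σ l)) := by
    have h := integral_image_eq_integral_abs_deriv_smul (s := Ioi a) measurableSet_Ioi
      (fun x _ => (aux_deriv c x hc0).hasDerivWithinAt) (aux_inj c a hc0 ha) (fun l => e l * D l)
    rw [aux_image c a hc0 ha] at h
    rw [hb, hσ]
    simp only
    rw [h, ← integral_neg]
    refine setIntegral_congr_fun measurableSet_Ioi fun x hx => ?_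
    have hx0 : 0 < x := lt_trans ha hx
    have := aux_phase_shift t x ht
    simp only [he, hw, hσ]
    rw [this, abs_of_nonneg (aux_w c x hc0 hx0).1, Complex.real_smul]
    ring
  have hcvi : IntegrableOn (fun l => (w l : ℂ) * (e l * D (σ l))) (Ioi a) := by
    have h := (integrableOn_image_iff_integrableOn_abs_deriv_smul (s := Ioi a) measurableSet_Ioi
      (fun x _ => (aux_deriv c x hc0).hasDerivWithinAt) (aux_inj c a hc0 ha)
      (fun l => e l * D l)).1
    rw [aux_image c a hc0 ha] at h
    have h := (h (heD.mono_set (Ioi_subset_Ioi hb0.le))).neg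
    refine IntegrableOn.congr_fun h (fun x hx => ?_) measurableSet_Ioi
    have hx0 : 0 < x := lt_trans ha hx
    have := aux_phase_shift t x ht
    simp only [he, hw, hσ, Pi.neg_apply]
    rw [this, abs_of_nonneg (aux_w c x hc0 hx0).1, Complex.real_smul]
    ring
  have hsplit : ∀ x y : ℝ, 0 ≤ x → x ≤ y → ∫ l in Ioi x, e l * D l
      = (∫ l in Ioc x y, e l * D l) + ∫ l in Ioi y, e l * D l := by
    intro x y hx hxy
    rw [← setIntegral_union (Ioc_disjoint_Ioi le_rfl) measurableSet_Ioi
      (heD.mono_set (fun z hz => lt_of_le_of_lt hx hz.1))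
      (heD.mono_set (Ioi_subset_Ioi (hx.trans hxy))), Ioc_union_Ioi_eq_Ioi hxy]
  have hloc : ∀ x y : ℝ, 0 ≤ x → 0 ≤ y → ‖∫ l in Ioc x y, e l * D l‖ ≤ (1 + y ^ 2 * t) * A := by
    intro x y hx hy
    have hsub : Ioc x y ⊆ Ioi 0 := fun z hz => lt_of_le_of_lt hx hz.1
    calc ‖∫ l in Ioc x y, e l * D l‖
        ≤ ∫ l in Ioc x y, (1 + y ^ 2 * t) * (‖D l‖ / (1 + l ^ 2 * t)) := by
          refine norm_integral_le_of_norm_le ((hA.mono_set hsub).const_mul _) ?_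
          refine (ae_restrict_iff' measurableSet_Ioc).2 (Filter.Eventually.of_forall fun l hl => ?_)
          rw [norm_mul, hen, one_mul, mul_div_assoc', le_div_iff₀ (by positivity), mul_comm]
          have : l ^ 2 ≤ y ^ 2 := pow_le_pow_left₀ (hsub hl).le hl.2 2
          gcongr
      _ = (1 + y ^ 2 * t) * ∫ l in Ioc x y, (‖D l‖ / (1 + l ^ 2 * t)) := integral_const_mul _ _
      _ ≤ (1 + y ^ 2 * t) * A := by
          gcongr
          exact setIntegral_mono_set hA (Filter.Eventually.of_forall hAnn) hsub.eventuallyLE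
  have hmain : ‖(∫ l in Ioi a, e l * D l) + ∫ l in Ioi b, e l * D l‖
      ≤ B + 2 * Real.pi * A := by
    rw [hcv, ← sub_eq_add_neg, ← integral_sub (heD.mono_set (Ioi_subset_Ioi ha.le)) hcvi]
    have hAa := (hA.mono_set (Ioi_subset_Ioi ha.le)).const_mul (2 * Real.pi)
    calc _ ≤ ∫ l in Ioi a, (‖D (σ l) - D l‖ + 2 * Real.pi * (‖D l‖ / (1 + l ^ 2 * t))) := by
          refine norm_integral_le_of_norm_le (hB.add hAa) ?_
          refine (ae_restrict_iff' measurableSet_Ioi).2 (Filter.Eventually.of_forall fun l hl => ?_)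
          have hl0 : 0 < l := lt_trans ha hl
          obtain ⟨w0, w1, w2⟩ := aux_w c l hc0 hl0
          change 0 ≤ w l at w0
          change w l ≤ 1 at w1
          change 1 - w l ≤ _ at w2
          have hid : e l * D l - (w l : ℂ) * (e l * D (σ l))
              = e l * (-((w l : ℂ) * (D (σ l) - D l)) + ((1 - w l : ℝ) : ℂ) * D l) := by
            push_cast; ring
          rw [hid, norm_mul, hen, one_mul]
          refine (norm_add_le _ _).trans ?_
          rw [norm_neg, norm_mul, norm_mul, Complex.norm_real, Complex.norm_real,
            Real.norm_of_nonneg w0, Real.norm_of_nonneg (by linarith : 0 ≤ 1 - w l)]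
          have h1 : 1 - w l ≤ 2 * Real.pi / (1 + l ^ 2 * t) := by
            refine w2.trans ?_
            have hlt : 1 ≤ l ^ 2 * t := by
              rw [← hat]
              have : a ^ 2 ≤ l ^ 2 := pow_le_pow_left₀ ha.le (le_of_lt hl) 2
              gcongr
            rw [hc, div_div, div_le_div_iff₀ (by positivity) (by positivity)]
            nlinarith
          apply add_le_add
          · exact mul_le_of_le_one_left (norm_nonneg _) w1
          · calc (1 - w l) * ‖D l‖ ≤ 2 * Real.pi / (1 + l ^ 2 * t) * ‖D l‖ := by gcongr
              _ = _ := by ring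
      _ = B + 2 * Real.pi * ∫ l in Ioi a, (‖D l‖ / (1 + l ^ 2 * t)) := by
          rw [integral_add hB hAa, integral_const_mul]
      _ ≤ B + 2 * Real.pi * A := by
          gcongr
          exact setIntegral_mono_set hA (Filter.Eventually.of_forall hAnn)
            (Ioi_subset_Ioi ha.le).eventuallyLE
  have hA0 : 0 ≤ A := integral_nonneg hAnn
  have hB0 : 0 ≤ B := integral_nonneg fun _ => norm_nonneg _
  have e1 := hsplit 0 a le_rfl ha.le
  have e2 := hsplit a b ha.le hab
  have l1 := hloc 0 a le_rfl ha.le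
  have l2 := hloc a b ha.le hb0.le
  rw [hat] at l1
  rw [hb2] at l2
  have e3 : (2:ℂ) * ∫ l in Ioi (0:ℝ), e l * D l = 2 * (∫ l in Ioc 0 a, e l * D l)
      + (∫ l in Ioc a b, e l * D l) +
        ((∫ l in Ioi a, e l * D l) + ∫ l in Ioi b, e l * D l) := by
    rw [e1, e2]; ring
  have e4 : 2 * ‖∫ l in Ioi (0:ℝ), e l * D l‖ ≤ 2 * ‖∫ l in Ioc 0 a, e l * D l‖
      + ‖∫ l in Ioc a b, e l * D l‖ +
        ‖(∫ l in Ioi a, e l * D l) + ∫ l in Ioi b, e l * D l‖ := by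
    have h := congrArg norm e3
    rw [norm_mul, Complex.norm_two] at h
    rw [h]
    refine norm_add₃_le.trans ?_
    rw [norm_mul, Complex.norm_two]
  change ‖∫ l in Ioi (0:ℝ), e l * D l‖ ≤ 16 * (A + B)
  nlinarith

/-- Lemma 4.6 of the paper. -/
theorem stmt1 :
    ∃ C : ℝ, 0 < C ∧ ∀ (E : ℝ → ℂ),
      ContinuousOn E (Ici 0) →
      HasCompactSupport E →
      ContDiffOn ℝ 1 E (Ioi 0) →
      E 0 = 0 →
      ∀ t : ℝ, 2 < t →
      IntegrableOn (fun l : ℝ => ‖deriv E l‖ / (1 + l ^ 2 * t)) (Ioi 0) →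
      IntegrableOn (fun l : ℝ => ‖deriv E (Real.sqrt (l ^ 2 + Real.pi / t)) - deriv E l‖)
        (Ioi (t ^ (-(1/2) : ℝ))) →
      ‖∫ l in Ioi (0:ℝ), Complex.exp (Complex.I * (t:ℂ) * (l:ℂ) ^ 2) * (l:ℂ) * E l‖
        ≤ C * ((1 / t) * (∫ l in Ioi (0:ℝ), ‖deriv E l‖ / (1 + l ^ 2 * t))
            + (1 / t) * ∫ l in Ioi (t ^ (-(1/2) : ℝ)),
                ‖deriv E (Real.sqrt (l ^ 2 + Real.pi / t)) - deriv E l‖) := by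
  refine ⟨8, by norm_num, ?_⟩
  intro E hE hsupp hdiff hE0 t ht hA hB
  have ht0 : 0 < t := by linarith
  have htc : (t:ℂ) ≠ 0 := by exact_mod_cast ht0.ne'
  obtain ⟨R, hR⟩ := hsupp.isCompact.isBounded.subset_closedBall 0
  have hR0 : ∀ l, R < |l| → E l = 0 := by
    intro l hl
    apply image_eq_zero_of_notMem_tsupport
    intro h
    have := hR h
    rw [mem_closedBall_zero_iff, Real.norm_eq_abs] at this
    linarith
  have hD0 : ∀ l, R < |l| → deriv E l = 0 := by
    intro l hl
    by_contra h
    have h1 : l ∈ tsupport E := support_deriv_subset h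
    have := hR h1
    rw [mem_closedBall_zero_iff, Real.norm_eq_abs] at this
    linarith
  have hD : IntegrableOn (deriv E) (Ioi 0) := by
    refine Integrable.mono' (hA.const_mul (1 + R ^ 2 * t))
      (measurable_deriv E).aestronglyMeasurable (Filter.Eventually.of_forall fun l => ?_)
    by_cases hl : R < |l|
    · rw [hD0 l hl]; simp
    · rw [mul_div_assoc', le_div_iff₀ (by positivity), mul_comm]
      have : l ^ 2 ≤ R ^ 2 := by
        rw [← sq_abs l]
        exact pow_le_pow_left₀ (abs_nonneg _) (not_lt.1 hl) 2
      gcongr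
  have ha0 : 0 < t ^ (-(1/2) : ℝ) := Real.rpow_pos_of_pos ht0 _
  have hat : (t ^ (-(1/2) : ℝ)) ^ 2 * t = 1 := by
    rw [← Real.rpow_natCast, ← Real.rpow_mul ht0.le]
    norm_num
    rw [Real.rpow_neg_one]
    field_simp
  have key := aux_osc (deriv E) t ht0 hD hA _ ha0 hat hB
  set A := ∫ l in Ioi (0:ℝ), ‖deriv E l‖ / (1 + l ^ 2 * t)
  set B := ∫ l in Ioi (t ^ (-(1/2) : ℝ)),
                ‖deriv E (Real.sqrt (l ^ 2 + Real.pi / t)) - deriv E l‖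
  set e : ℝ → ℂ := fun l => Complex.exp (Complex.I * (t:ℂ) * (l:ℂ) ^ 2) with he
  have hecont : Continuous e := by simp only [he]; fun_prop
  have hen : ∀ l, ‖e l‖ = 1 := aux_phase_norm t
  have heD : IntegrableOn (fun l => e l * deriv E l) (Ioi 0) := by
    refine Integrable.mono hD (hecont.aestronglyMeasurable.mul hD.aestronglyMeasurable) ?_
    filter_upwards with l
    rw [norm_mul, hen, one_mul]
  have hcontF : ContinuousOn (fun l : ℝ => e l * (l:ℂ) * E l) (Ici 0) := by
    refine ContinuousOn.mul (Continuous.continuousOn ?_) hE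
    exact hecont.mul Complex.continuous_ofReal
  have heE : IntegrableOn (fun l : ℝ => e l * (l:ℂ) * E l) (Ioi 0) := by
    have h1 : IntegrableOn (fun l : ℝ => e l * (l:ℂ) * E l) (Icc 0 R) :=
      (hcontF.mono Icc_subset_Ici_self).integrableOn_Icc
    refine h1.of_forall_sdiff_eq_zero measurableSet_Ioi fun l hl => ?_
    have : R < |l| := by
      have h0 : 0 < l := hl.1
      rw [abs_of_pos h0]
      by_contra h
      exact hl.2 ⟨h0.le, not_lt.1 h⟩
    rw [hR0 l this, mul_zero]
  have hee : ∀ l : ℝ, HasDerivAt e (e l * (2 * Complex.I * t * l)) l := by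
    intro l
    have h1 : HasDerivAt (fun x : ℝ => (x:ℂ)) 1 l := Complex.ofRealCLM.hasDerivAt
    have h2 := ((h1.pow 2).const_mul (Complex.I * (t:ℂ))).cexp
    refine h2.congr_deriv ?_
    change e l * _ = _
    push_cast; ring
  have hder : ∀ l ∈ Ioi (0:ℝ), HasDerivAt (fun l => e l * E l)
      (2 * Complex.I * t * (e l * l * E l) + e l * deriv E l) l := by
    intro l hl
    have h1 : HasDerivAt E (deriv E l) l :=
      ((hdiff.differentiableOn one_ne_zero).differentiableAt (Ioi_mem_nhds hl)).hasDerivAt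
    exact ((hee l).mul h1).congr_deriv (by ring)
  have hFTC := integral_Ioi_of_hasDerivAt_of_tendsto (a := 0) (m := 0)
    (f := fun l => e l * E l)
    ((hecont.continuousWithinAt).mul (hE 0 self_mem_Ici)) hder
    ((heE.const_mul (2 * Complex.I * t)).add heD)
    (by
      refine tendsto_const_nhds.congr' ?_
      filter_upwards [Filter.eventually_gt_atTop R] with l hl
      rw [hR0 l (lt_of_lt_of_le hl (le_abs_self l)), mul_zero])
  rw [integral_add (heE.const_mul (2 * Complex.I * t)) heD, integral_const_mul, hE0] at hFTC
  simp only [mul_zero, sub_zero] at hFTC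
  have h2 := congrArg norm (eq_neg_of_add_eq_zero_left hFTC)
  rw [norm_neg, norm_mul] at h2
  have h3 : ‖2 * Complex.I * (t:ℂ)‖ = 2 * t := by
    simp [abs_of_pos ht0]
  rw [h3] at h2
  change ‖∫ l in Ioi (0:ℝ), e l * (l:ℂ) * E l‖ ≤ _
  change ‖∫ l in Ioi (0:ℝ), e l * deriv E l‖ ≤ _ at key
  rw [← h2] at key
  have : 8 * (1 / t * A + 1 / t * B) = 8 * (A + B) / t := by ring
  rw [this, le_div_iff₀ ht0]
  linarith
end
end

section
/- Let χ : ℝ → ℝ be a smooth compactly supported function which is constant on a neighborhood of 0. Then there is a constant C (depending on χ) such that for all t > 2, | ∫₀^∞ e^{itλ²} λ χ(λ) dλ − i χ(0)/(2t) | ≤ C / t². -/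
open MeasureTheory Set

noncomputable section

/-- One integration by parts. -/
lemma ibp_step (u : ℝ → ℝ) (hu : ContDiff ℝ 1 u) (hs : HasCompactSupport u) (t : ℝ) (ht : 0 < t) :
    (∫ l in Ioi (0:ℝ), Complex.exp (Complex.I * (t:ℂ) * (l:ℂ) ^ 2) * (l:ℂ) * (u l : ℂ))
      = Complex.I / (2 * (t:ℂ)) * ((u 0 : ℂ) +
        ∫ l in Ioi (0:ℝ), Complex.exp (Complex.I * (t:ℂ) * (l:ℂ) ^ 2) * ((deriv u l : ℝ) : ℂ)) := by
  have hc : Continuous (fun l : ℝ => Complex.exp (Complex.I * (t:ℂ) * (l:ℂ) ^ 2)) := by fun_prop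
  have hsC : HasCompactSupport (fun l : ℝ => ((u l : ℝ) : ℂ)) :=
    hs.comp_left (g := fun x : ℝ => (x : ℂ)) (by simp)
  have hsC' : HasCompactSupport (fun l : ℝ => ((deriv u l : ℝ) : ℂ)) :=
    hs.deriv.comp_left (g := fun x : ℝ => (x : ℂ)) (by simp)
  have hd : ∀ l : ℝ, HasDerivAt
      (fun l : ℝ => Complex.exp (Complex.I * (t:ℂ) * (l:ℂ) ^ 2) * (u l : ℂ))
      ((2 * Complex.I * t) * (Complex.exp (Complex.I * (t:ℂ) * (l:ℂ) ^ 2) * (l:ℂ) * (u l : ℂ)) +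
        Complex.exp (Complex.I * (t:ℂ) * (l:ℂ) ^ 2) * ((deriv u l : ℝ) : ℂ)) l := by
    intro l
    have h1 : HasDerivAt (fun l : ℝ => (u l : ℂ)) ((deriv u l : ℝ) : ℂ) l :=
      ((hu.differentiable (by norm_num)) l).hasDerivAt.ofReal_comp
    have h2 : HasDerivAt (fun l : ℝ => Complex.exp (Complex.I * (t:ℂ) * (l:ℂ) ^ 2))
        (Complex.exp (Complex.I * (t:ℂ) * (l:ℂ) ^ 2) * (Complex.I * (t:ℂ) * (2 * (l:ℂ)))) l := by
      have h3 : HasDerivAt (fun z : ℂ => z ^ 2) (2 * (l:ℂ)) (l:ℂ) := by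
        simpa using hasDerivAt_pow 2 (l:ℂ)
      exact ((h3.const_mul (Complex.I * (t:ℂ))).cexp).comp_ofReal
    refine (h2.mul h1).congr_deriv ?_
    ring
  have hi1 : Integrable (fun l : ℝ =>
      (2 * Complex.I * t) * (Complex.exp (Complex.I * (t:ℂ) * (l:ℂ) ^ 2) * (l:ℂ) * (u l : ℂ))) := by
    apply Integrable.const_mul
    apply Continuous.integrable_of_hasCompactSupport
    · have := hu.continuous
      fun_prop
    · exact hsC.mul_left
  have hi2 : Integrable (fun l : ℝ =>
      Complex.exp (Complex.I * (t:ℂ) * (l:ℂ) ^ 2) * ((deriv u l : ℝ) : ℂ)) := by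
    apply Continuous.integrable_of_hasCompactSupport
    · have := hu.continuous_deriv le_rfl
      fun_prop
    · exact hsC'.mul_left
  have hlim : Filter.Tendsto
      (fun l : ℝ => Complex.exp (Complex.I * (t:ℂ) * (l:ℂ) ^ 2) * (u l : ℂ)) Filter.atTop
      (nhds 0) := by
    have h2f : HasCompactSupport
      (fun l : ℝ => Complex.exp (Complex.I * (t:ℂ) * (l:ℂ) ^ 2) * (u l : ℂ)) := hsC.mul_left
    rw [hasCompactSupport_iff_eventuallyEq, Filter.coclosedCompact_eq_cocompact] at h2f
    exact h2f.filter_mono _root_.atTop_le_cocompact |>.tendsto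
  have key := integral_Ioi_of_hasDerivAt_of_tendsto' (a := 0) (fun x _ => hd x)
    (hi1.add hi2).integrableOn hlim
  rw [integral_add hi1.integrableOn hi2.integrableOn, integral_const_mul] at key
  have ht' : (t:ℂ) ≠ 0 := by exact_mod_cast ht.ne'
  simp only [Complex.ofReal_zero, ne_eq, OfNat.ofNat_ne_zero, not_false_eq_true, zero_pow,
    mul_zero, Complex.exp_zero, one_mul, zero_sub] at key
  generalize (∫ l in Ioi (0:ℝ),
    Complex.exp (Complex.I * (t:ℂ) * (l:ℂ) ^ 2) * (l:ℂ) * (u l : ℂ)) = A at *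
  generalize (∫ l in Ioi (0:ℝ),
    Complex.exp (Complex.I * (t:ℂ) * (l:ℂ) ^ 2) * ((deriv u l : ℝ) : ℂ)) = B at *
  field_simp
  linear_combination (-Complex.I) * key + (2 * t * A) * Complex.I_sq

/-- Estimate (4.7) of the paper. -/
theorem stmt2 (χ : ℝ → ℝ) (hχ : ContDiff ℝ (⊤ : ℕ∞) χ) (hsupp : HasCompactSupport χ)
    (hconst : ∃ ε > 0, ∀ s : ℝ, |s| < ε → χ s = χ 0) :
    ∃ C : ℝ, 0 < C ∧ ∀ t : ℝ, 2 < t →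
      ‖(∫ l in Ioi (0:ℝ), Complex.exp (Complex.I * (t:ℂ) * (l:ℂ) ^ 2) * (l:ℂ) * (χ l : ℂ))
          - Complex.I * (χ 0 : ℂ) / (2 * (t:ℂ))‖ ≤ C / t ^ 2 := by
  obtain ⟨ε, hε, hconst⟩ := hconst
  have hχ1 : ContDiff ℝ 1 χ := hχ.of_le (by exact_mod_cast le_top)
  have hχ2 : ContDiff ℝ 1 (deriv χ) := by
    have h2 : ContDiff ℝ (1 + 1) χ := by
      rw [one_add_one_eq_two]
      exact hχ.of_le (WithTop.coe_le_coe.2 (le_top : (2 : ℕ∞) ≤ ⊤))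
    exact (contDiff_succ_iff_deriv.1 h2).2.2
  set u : ℝ → ℝ := fun l => deriv χ l * l⁻¹ with hu_def
  have hd0 : ∀ s : ℝ, |s| < ε → deriv χ s = 0 := by
    intro s hs
    have : χ =ᶠ[nhds s] fun _ => χ 0 := by
      filter_upwards [(isOpen_lt continuous_abs continuous_const).mem_nhds hs] with x hx
      exact hconst x hx
    rw [this.deriv_eq]; simp
  have hu : ContDiff ℝ 1 u := by
    rw [contDiff_iff_contDiffAt]
    intro x
    by_cases hx : x = 0
    · have : u =ᶠ[nhds x] fun _ => 0 := by
        have hx' : |x| < ε := by simpa [hx] using hε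
        filter_upwards [(isOpen_lt continuous_abs continuous_const).mem_nhds hx'] with y hy
        simp [hu_def, hd0 y hy]
      exact contDiffAt_const.congr_of_eventuallyEq this
    · exact hχ2.contDiffAt.mul (contDiffAt_inv ℝ hx)
  have hus : HasCompactSupport u := hsupp.deriv.mul_right
  refine ⟨(∫ l in Ioi (0:ℝ), ‖deriv u l‖) + 1, ?_, ?_⟩
  · have : 0 ≤ ∫ l in Ioi (0:ℝ), ‖deriv u l‖ := integral_nonneg fun _ => norm_nonneg _
    linarith
  intro t ht
  have ht0 : 0 < t := by linarith
  have e1 := ibp_step χ hχ1 hsupp t ht0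
  have e2 := ibp_step u hu hus t ht0
  have e3 : (∫ l in Ioi (0:ℝ), Complex.exp (Complex.I * (t:ℂ) * (l:ℂ) ^ 2) * (l:ℂ) * (u l : ℂ))
      = ∫ l in Ioi (0:ℝ), Complex.exp (Complex.I * (t:ℂ) * (l:ℂ) ^ 2) * ((deriv χ l : ℝ) : ℂ) := by
    apply setIntegral_congr_fun measurableSet_Ioi
    intro l hl
    have : (l:ℂ) ≠ 0 := by exact_mod_cast (ne_of_gt hl)
    simp only [hu_def]
    push_cast
    field_simp
  have hu0 : u 0 = 0 := by simp [hu_def]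
  rw [e1, ← e3, e2, hu0]
  have hB : ‖∫ l in Ioi (0:ℝ), Complex.exp (Complex.I * (t:ℂ) * (l:ℂ) ^ 2) *
      ((deriv u l : ℝ) : ℂ)‖ ≤ ∫ l in Ioi (0:ℝ), ‖deriv u l‖ := by
    refine (norm_integral_le_integral_norm _).trans (le_of_eq ?_)
    congr 1
    ext l
    have : Complex.I * (t:ℂ) * (l:ℂ) ^ 2 = ((t * l ^ 2 : ℝ) : ℂ) * Complex.I := by
      push_cast; ring
    rw [norm_mul, this, Complex.norm_exp_ofReal_mul_I, one_mul, Complex.norm_real]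
  have hB0 := (norm_nonneg _).trans hB
  generalize (∫ l in Ioi (0:ℝ), Complex.exp (Complex.I * (t:ℂ) * (l:ℂ) ^ 2) *
      ((deriv u l : ℝ) : ℂ)) = B at *
  have : Complex.I / (2 * (t:ℂ)) * ((χ 0 : ℂ) + Complex.I / (2 * (t:ℂ)) * (((0:ℝ):ℂ) + B)) -
      Complex.I * (χ 0 : ℂ) / (2 * (t:ℂ)) =
      (Complex.I / (2 * (t:ℂ))) * (Complex.I / (2 * (t:ℂ))) * B := by
    push_cast; ring
  rw [this]
  simp only [norm_mul, norm_div, Complex.norm_I, Complex.norm_real, Complex.norm_ofNat,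
    Real.norm_of_nonneg ht0.le]
  have h4 : 1 / (2 * t) * (1 / (2 * t)) * ‖B‖ = (‖B‖ / 4) / t ^ 2 := by
    field_simp; ring
  rw [h4]
  gcongr
  have := norm_nonneg B
  linarith
end
end

section
/- Let c₁, c₂, a, b, a', b' ∈ ℝ with c₂ ≠ 0. There exist λ₁ ∈ (0, 1/2) and a constant C such that for every smooth function χ : ℝ → ℝ with 0 ≤ χ ≤ 1, supported in [−λ₁, λ₁] and equal to 1 on [−λ₁/2, λ₁/2], there is a constant C' (depending on χ, c₁, c₂, a, b, a', b') so that for all t > 2 and all x, x₁, y, y₁ ∈ ℝ² with x ≠ x₁ and y ≠ y₁: | ∫₀^∞ e^{itλ²} λ χ(λ) (a log|x−x₁| + b)(a' log|y−y₁| + b') / ((log λ + c₁)² + c₂²) dλ | ≤ C' k(x,x₁) k(y,y₁) √(w(x) w(y)) / (t log²(t)). -/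
open MeasureTheory Set

noncomputable section

/-- `log⁻(s) = |log s|` for `0 < s < 1`, zero otherwise. -/
def logMinus (s : ℝ) : ℝ := if 0 < s ∧ s < 1 then |Real.log s| else 0

/-- `log⁺(s) = log s` for `s > 1`, zero otherwise. -/
def logPlus (s : ℝ) : ℝ := if 1 < s then Real.log s else 0

/-- The kernel `k(x,x₁) = 1 + log⁻(|x−x₁|) + log⁺(|x₁|)`. -/
def kker (x x₁ : EuclideanSpace ℝ (Fin 2)) : ℝ := 1 + logMinus ‖x - x₁‖ + logPlus ‖x₁‖

/-- The weight `w(x) = log²(2+|x|)`. -/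
def wwt (x : EuclideanSpace ℝ (Fin 2)) : ℝ := Real.log (2 + ‖x‖) ^ 2

lemma logMinus_nonneg (s : ℝ) : 0 ≤ logMinus s := by
  unfold logMinus; split_ifs <;> positivity

lemma logPlus_nonneg (s : ℝ) : 0 ≤ logPlus s := by
  unfold logPlus; split_ifs with h
  · exact (Real.log_pos h).le
  · exact le_rfl

lemma kker_one_le (x x₁ : EuclideanSpace ℝ (Fin 2)) : 1 ≤ kker x x₁ := by
  unfold kker; linarith [logMinus_nonneg ‖x - x₁‖, logPlus_nonneg ‖x₁‖]

lemma half_le_L (x : EuclideanSpace ℝ (Fin 2)) : 1 / 2 ≤ Real.log (2 + ‖x‖) := by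
  have h1 : Real.log 2 ≤ Real.log (2 + ‖x‖) :=
    Real.log_le_log (by norm_num) (by linarith [norm_nonneg x])
  linarith [Real.log_two_gt_d9]

lemma kernel_bound (a b : ℝ) (x x₁ : EuclideanSpace ℝ (Fin 2)) (h : x ≠ x₁) :
    |a * Real.log ‖x - x₁‖ + b| ≤ (|a| + |b|) * 3 * (kker x x₁ * Real.log (2 + ‖x‖)) := by
  have hk := kker_one_le x x₁
  have hL := half_le_L x
  set L := Real.log (2 + ‖x‖) with hLdef
  have hpos : 0 < ‖x - x₁‖ := norm_pos_iff.mpr (sub_ne_zero.mpr h)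
  have hlog : |Real.log ‖x - x₁‖| ≤ logMinus ‖x - x₁‖ + logPlus ‖x₁‖ + L := by
    by_cases h1 : ‖x - x₁‖ < 1
    · have : logMinus ‖x - x₁‖ = |Real.log ‖x - x₁‖| := by
        unfold logMinus; rw [if_pos ⟨hpos, h1⟩]
      rw [this]; linarith [logPlus_nonneg ‖x₁‖]
    · push Not at h1
      rw [abs_of_nonneg (Real.log_nonneg h1)]
      have hm := logMinus_nonneg ‖x - x₁‖
      have htri : ‖x - x₁‖ ≤ ‖x‖ + ‖x₁‖ := norm_sub_le _ _
      have hx := norm_nonneg x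
      unfold logPlus
      split_ifs with h2
      · have : Real.log ‖x - x₁‖ ≤ Real.log ((2 + ‖x‖) * ‖x₁‖) := by
          apply Real.log_le_log hpos
          nlinarith
        rw [Real.log_mul (by positivity) (by positivity)] at this
        linarith
      · have : Real.log ‖x - x₁‖ ≤ Real.log (2 + ‖x‖) := by
          apply Real.log_le_log hpos
          linarith
        linarith
  have hlk : |Real.log ‖x - x₁‖| + 1 ≤ 3 * (kker x x₁ * L) := by
    have : |Real.log ‖x - x₁‖| + 1 ≤ kker x x₁ + L := by unfold kker; linarith
    nlinarith
  calc |a * Real.log ‖x - x₁‖ + b| ≤ |a| * |Real.log ‖x - x₁‖| + |b| := by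
        rw [← abs_mul]; exact abs_add_le _ _
    _ ≤ (|a| + |b|) * (|Real.log ‖x - x₁‖| + 1) := by
        nlinarith [abs_nonneg a, abs_nonneg b, abs_nonneg (Real.log ‖x - x₁‖),
          mul_nonneg (abs_nonneg b) (abs_nonneg (Real.log ‖x - x₁‖))]
    _ ≤ (|a| + |b|) * (3 * (kker x x₁ * L)) := by gcongr
    _ = _ := by ring

/-- Oscillating phase. -/
def ph (t l : ℝ) : ℂ := Complex.exp (Complex.I * (t:ℂ) * (l:ℂ) ^ 2)

lemma norm_ph (t l : ℝ) : ‖ph t l‖ = 1 := by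
  unfold ph
  have : Complex.I * (t:ℂ) * (l:ℂ) ^ 2 = ((t * l ^ 2 : ℝ) : ℂ) * Complex.I := by
    push_cast; ring
  rw [this, Complex.norm_exp_ofReal_mul_I]

lemma continuous_ph (t : ℝ) : Continuous (ph t) := by
  unfold ph; fun_prop

lemma hasDerivAt_ph (t l : ℝ) : HasDerivAt (ph t) (2 * Complex.I * t * (ph t l * l)) l := by
  unfold ph
  have h1 : HasDerivAt (fun z : ℂ => Complex.exp (Complex.I * (t:ℂ) * z ^ 2))
      (Complex.exp (Complex.I * (t:ℂ) * (l:ℂ) ^ 2) * (Complex.I * (t:ℂ) * (2 * (l:ℂ)))) (l:ℂ) := by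
    have := ((hasDerivAt_pow 2 (l:ℂ)).const_mul (Complex.I * (t:ℂ))).cexp
    simpa using this
  have := h1.comp_ofReal
  convert this using 1
  ring

lemma ibp (t p q : ℝ) (ht : 0 < t) (f f' : ℝ → ℝ)
    (hf : ∀ x ∈ uIcc p q, HasDerivAt f (f' x) x) (hf' : ContinuousOn f' (uIcc p q)) :
    ∫ l in p..q, ph t l * l * (f l : ℂ) =
      (2 * Complex.I * t)⁻¹ * (ph t q * f q - ph t p * f p - ∫ l in p..q, ph t l * (f' l : ℂ)) := by
  have hne : (2 * Complex.I * t : ℂ) ≠ 0 := by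
    have : (t:ℂ) ≠ 0 := by exact_mod_cast ht.ne'
    simp [this]
  have h := intervalIntegral.integral_mul_deriv_eq_deriv_mul (a := p) (b := q)
    (u := fun l => (f l : ℂ)) (u' := fun l => (f' l : ℂ)) (v := ph t)
    (v' := fun l => 2 * Complex.I * t * (ph t l * l))
    (fun x hx => (hf x hx).ofReal_comp) (fun x _ => hasDerivAt_ph t x)
    (ContinuousOn.intervalIntegrable (Complex.continuous_ofReal.comp_continuousOn hf'))
    (Continuous.intervalIntegrable (by have := continuous_ph t; fun_prop) _ _)
  have e1 : ∫ l in p..q, (f l : ℂ) * (2 * Complex.I * t * (ph t l * l)) =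
      (2 * Complex.I * t) * ∫ l in p..q, ph t l * l * (f l : ℂ) := by
    rw [← intervalIntegral.integral_const_mul]
    congr 1; ext l; ring
  have e2 : ∫ l in p..q, (f' l : ℂ) * ph t l = ∫ l in p..q, ph t l * (f' l : ℂ) := by
    congr 1; ext l; ring
  rw [e1, e2] at h
  rw [eq_inv_mul_iff_mul_eq₀ hne, h]; ring

lemma norm_pref (t : ℝ) (ht : 0 < t) : ‖(2 * Complex.I * t : ℂ)⁻¹‖ = (2 * t)⁻¹ := by
  simp [abs_of_pos ht]

lemma ibp_norm (t p q : ℝ) (ht : 0 < t) (hpq : p ≤ q) (f f' B : ℝ → ℝ)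
    (hf : ∀ x ∈ uIcc p q, HasDerivAt f (f' x) x) (hf' : ContinuousOn f' (uIcc p q))
    (hB : ∀ x ∈ Icc p q, |f' x| ≤ B x) (hBi : IntervalIntegrable B volume p q) :
    ‖∫ l in p..q, ph t l * l * (f l : ℂ)‖ ≤
      (2 * t)⁻¹ * (|f q| + |f p| + ∫ l in p..q, B l) := by
  rw [ibp t p q ht f f' hf hf', norm_mul, norm_pref t ht]
  gcongr
  have h3 : ‖∫ l in p..q, ph t l * (f' l : ℂ)‖ ≤ ∫ l in p..q, B l := by
    apply intervalIntegral.norm_integral_le_of_norm_le hpq _ hBi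
    refine Filter.Eventually.of_forall fun x hx => ?_
    rw [norm_mul, norm_ph, one_mul, Complex.norm_real]
    exact hB x (Ioc_subset_Icc_self hx)
  calc _ ≤ ‖ph t q * f q‖ + ‖ph t p * f p‖ + ‖∫ l in p..q, ph t l * (f' l : ℂ)‖ :=
        (norm_sub_le _ _).trans (add_le_add_left (norm_sub_le _ _) _)
    _ ≤ _ := by
        rw [norm_mul, norm_mul, norm_ph, norm_ph]
        simpa using h3

def phi (c m u : ℝ) : ℝ := ((u + c) ^ 2 + m)⁻¹
def phi1 (c m u : ℝ) : ℝ := -(2 * (u + c)) * ((u + c) ^ 2 + m)⁻¹ ^ 2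
def phi2 (c m u : ℝ) : ℝ :=
  -2 * ((u + c) ^ 2 + m)⁻¹ ^ 2 + 8 * (u + c) ^ 2 * ((u + c) ^ 2 + m)⁻¹ ^ 3

lemma den_pos (c u : ℝ) {m : ℝ} (hm : 0 < m) : 0 < (u + c) ^ 2 + m := by positivity

lemma phi_deriv (c u : ℝ) {m : ℝ} (hm : 0 < m) : HasDerivAt (phi c m) (phi1 c m u) u := by
  have hd := (den_pos c u hm).ne'
  have h := ((((hasDerivAt_id u).add_const c).pow 2).add_const m).inv hd
  unfold phi phi1
  refine HasDerivAt.congr_deriv h ?_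
  simp; field_simp

lemma phi1_deriv (c u : ℝ) {m : ℝ} (hm : 0 < m) : HasDerivAt (phi1 c m) (phi2 c m u) u := by
  have h := ((((hasDerivAt_id u).add_const c).const_mul 2).neg).mul ((phi_deriv c u hm).pow 2)
  have hd := (den_pos c u hm).ne'
  unfold phi1 phi2
  refine HasDerivAt.congr_deriv h ?_
  simp [phi, phi1]
  generalize (u + c) ^ 2 + m = D at hd ⊢
  field_simp; ring

lemma phi_cont (c : ℝ) {m : ℝ} (hm : 0 < m) : Continuous (phi c m) :=
  continuous_iff_continuousAt.mpr fun u => (phi_deriv c u hm).continuousAt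
lemma phi1_cont (c : ℝ) {m : ℝ} (hm : 0 < m) : Continuous (phi1 c m) :=
  continuous_iff_continuousAt.mpr fun u => (phi1_deriv c u hm).continuousAt
lemma phi2_cont (c : ℝ) {m : ℝ} (hm : 0 < m) : Continuous (phi2 c m) := by
  unfold phi2
  have : Continuous fun u => ((u + c) ^ 2 + m)⁻¹ := phi_cont c hm
  fun_prop

lemma phi_nonneg (c u : ℝ) {m : ℝ} (hm : 0 < m) : 0 ≤ phi c m u := by unfold phi; positivity

lemma phi_bdd (c : ℝ) {m : ℝ} (hm : 0 < m) :
    ∃ K : ℝ, 0 < K ∧ ∀ u, |phi c m u| ≤ K ∧ |phi1 c m u| ≤ K ∧ |phi2 c m u| ≤ K := by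
  refine ⟨m⁻¹ + (1 + m⁻¹) * m⁻¹ + 10 * m⁻¹ ^ 2, by positivity, fun u => ?_⟩
  have hd := den_pos c u hm
  set v := u + c with hv
  set r := (v ^ 2 + m)⁻¹ with hr
  have hr0 : 0 < r := by positivity
  have hrm : r ≤ m⁻¹ := by
    apply inv_anti₀ hm; nlinarith [sq_nonneg v]
  have hmi : 0 < m⁻¹ := by positivity
  have hvr : v ^ 2 * r ≤ 1 := by
    rw [hr, ← div_eq_mul_inv, div_le_one hd]; linarith
  have hvr0 : 0 ≤ v ^ 2 * r := by positivity
  have h1 : |phi c m u| ≤ m⁻¹ := by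
    change |r| ≤ _
    rwa [abs_of_pos hr0]
  have hr2 : r ^ 2 ≤ m⁻¹ ^ 2 := by gcongr
  have h2 : |phi1 c m u| ≤ (1 + m⁻¹) * m⁻¹ := by
    change |-(2 * v) * r ^ 2| ≤ _
    have e : |-(2 * v) * r ^ 2| = (2 * |v|) * r * r := by
      rw [abs_mul, abs_neg, abs_mul, abs_of_pos (pow_pos hr0 2)]; norm_num; ring
    rw [e]
    have : 2 * |v| ≤ 1 + v ^ 2 := by nlinarith [sq_nonneg (|v| - 1), sq_abs v]
    have h3 : 2 * |v| * r ≤ 1 + m⁻¹ := by nlinarith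
    gcongr
  have h3 : |phi2 c m u| ≤ 10 * m⁻¹ ^ 2 := by
    change |-2 * r ^ 2 + 8 * v ^ 2 * r ^ 3| ≤ _
    have e : 8 * v ^ 2 * r ^ 3 = 8 * (v ^ 2 * r) * r ^ 2 := by ring
    rw [e, abs_le]
    have := sq_nonneg r
    constructor <;> nlinarith [mul_nonneg hvr0 this, mul_le_mul_of_nonneg_right hvr this]
  have : 0 < (1 + m⁻¹) * m⁻¹ := by positivity
  have : 0 < 10 * m⁻¹ ^ 2 := by positivity
  refine ⟨?_, ?_, ?_⟩ <;> linarith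

lemma phi_decay (c : ℝ) {m : ℝ} (hm : 0 < m) :
    ∃ K : ℝ, 0 < K ∧ ∀ u, u ≠ 0 → phi c m u ≤ K / u ^ 2 := by
  refine ⟨2 + 2 * c ^ 2 / m, by positivity, fun u hu => ?_⟩
  unfold phi
  have hd := den_pos c u hm
  rw [inv_eq_one_div, div_le_div_iff₀ hd (by positivity)]
  have e : (2 + 2 * c ^ 2 / m) * ((u + c) ^ 2 + m) =
      2 * (u + c) ^ 2 + 2 * m + 2 * c ^ 2 / m * (u + c) ^ 2 + 2 * c ^ 2 := by
    field_simp; ring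
  rw [e]
  have : 0 ≤ 2 * c ^ 2 / m * (u + c) ^ 2 := by positivity
  nlinarith [sq_nonneg (u + 2 * c)]

lemma phi_mono (c : ℝ) {m : ℝ} (hm : 0 < m) {u v : ℝ} (huv : u ≤ v) (hv : v + c ≤ 0) :
    phi c m u ≤ phi c m v := by
  unfold phi
  apply inv_anti₀ (den_pos c v hm)
  nlinarith

lemma phi1_nonneg (c : ℝ) {m : ℝ} {u : ℝ} (hv : u + c ≤ 0) : 0 ≤ phi1 c m u := by
  unfold phi1
  apply mul_nonneg (by linarith) (by positivity)

/-- the outer part: `[δ,1]`. -/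
lemma outer (c : ℝ) {m : ℝ} (hm : 0 < m) (χ χ1 χ2 : ℝ → ℝ)
    (h0 : ∀ x, HasDerivAt χ (χ1 x) x) (h1 : ∀ x, HasDerivAt χ1 (χ2 x) x) (h2 : Continuous χ2)
    (hone : χ 1 = 0) :
    ∃ K : ℝ, 0 < K ∧ ∀ t d : ℝ, 0 < t → 0 < d → d ≤ 1 →
      ‖∫ l in d..1, ph t l * l * ((χ l * phi c m (Real.log l) : ℝ) : ℂ)‖ ≤
        (2 * t)⁻¹ * (|χ d * phi c m (Real.log d)| + (2 * t)⁻¹ * (K / d ^ 2)) := by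
  have c0 : Continuous χ := continuous_iff_continuousAt.mpr fun u => (h0 u).continuousAt
  have c1 : Continuous χ1 := continuous_iff_continuousAt.mpr fun u => (h1 u).continuousAt
  obtain ⟨K, hK, hphi⟩ := phi_bdd c hm
  obtain ⟨M0, hM0⟩ := isCompact_Icc.exists_bound_of_continuousOn (s := Icc (0:ℝ) 1) c0.continuousOn
  obtain ⟨M1, hM1⟩ := isCompact_Icc.exists_bound_of_continuousOn (s := Icc (0:ℝ) 1) c1.continuousOn
  obtain ⟨M2, hM2⟩ := isCompact_Icc.exists_bound_of_continuousOn (s := Icc (0:ℝ) 1) h2.continuousOn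
  set M := |M0| + |M1| + |M2| + 1 with hM
  have hMpos : 0 < M := by positivity
  have b0 : ∀ x ∈ Icc (0:ℝ) 1, |χ x| ≤ M := fun x hx => by
    have := hM0 x hx; rw [Real.norm_eq_abs] at this
    linarith [le_abs_self M0, abs_nonneg M1, abs_nonneg M2]
  have b1 : ∀ x ∈ Icc (0:ℝ) 1, |χ1 x| ≤ M := fun x hx => by
    have := hM1 x hx; rw [Real.norm_eq_abs] at this
    linarith [le_abs_self M1, abs_nonneg M0, abs_nonneg M2]
  have b2 : ∀ x ∈ Icc (0:ℝ) 1, |χ2 x| ≤ M := fun x hx => by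
    have := hM2 x hx; rw [Real.norm_eq_abs] at this
    linarith [le_abs_self M2, abs_nonneg M1, abs_nonneg M0]
  refine ⟨20 * (M * K), by positivity, fun t d ht hd hd1 => ?_⟩
  set P := fun l => phi c m (Real.log l) with hP
  set P1 := fun l => phi1 c m (Real.log l) with hP1
  set P2 := fun l => phi2 c m (Real.log l) with hP2
  have dP : ∀ x, 0 < x → HasDerivAt P (P1 x * x⁻¹) x := fun x hx =>
    (phi_deriv c (Real.log x) hm).comp x (Real.hasDerivAt_log hx.ne')
  have dP1 : ∀ x, 0 < x → HasDerivAt P1 (P2 x * x⁻¹) x := fun x hx =>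
    (phi1_deriv c (Real.log x) hm).comp x (Real.hasDerivAt_log hx.ne')
  have hsub : uIcc d 1 = Icc d 1 := uIcc_of_le hd1
  have hpos : ∀ x ∈ Icc d 1, 0 < x := fun x hx => lt_of_lt_of_le hd hx.1
  have clog : ContinuousOn Real.log (Icc d 1) :=
    Real.continuousOn_log.mono fun x hx => (hpos x hx).ne'
  have cinv : ContinuousOn (fun x : ℝ => x⁻¹) (Icc d 1) :=
    continuousOn_inv₀.mono fun x hx => (hpos x hx).ne'
  have cP : ContinuousOn P (Icc d 1) := (phi_cont c hm).comp_continuousOn clog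
  have cP1 : ContinuousOn P1 (Icc d 1) := (phi1_cont c hm).comp_continuousOn clog
  have cP2 : ContinuousOn P2 (Icc d 1) := (phi2_cont c hm).comp_continuousOn clog
  have k0 := c0.continuousOn (s := Icc d 1)
  have k1 := c1.continuousOn (s := Icc d 1)
  have k2 := h2.continuousOn (s := Icc d 1)
  set F' := fun x => χ1 x * P x + χ x * (P1 x * x⁻¹) with hF'
  set H := fun x => (χ1 x * P x + χ x * (P1 x * x⁻¹)) * x⁻¹ with hH
  set H' := fun x => (χ2 x * P x + χ1 x * (P1 x * x⁻¹) + (χ1 x * (P1 x * x⁻¹) +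
    χ x * (P2 x * x⁻¹ * x⁻¹ + P1 x * (-(x ^ 2)⁻¹)))) * x⁻¹ +
    (χ1 x * P x + χ x * (P1 x * x⁻¹)) * (-(x ^ 2)⁻¹) with hH'
  have dF : ∀ x ∈ uIcc d 1, HasDerivAt (fun l => χ l * phi c m (Real.log l)) (F' x) x :=
    fun x hx => (h0 x).mul (dP x (hpos x (hsub ▸ hx)))
  have cF' : ContinuousOn F' (uIcc d 1) := by
    rw [hsub]; exact (k1.mul cP).add (k0.mul (cP1.mul cinv))
  have dH : ∀ x ∈ uIcc d 1, HasDerivAt H (H' x) x := fun x hx => by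
    have hx := hpos x (hsub ▸ hx)
    have hi := hasDerivAt_inv hx.ne'
    exact (((h1 x).mul (dP x hx)).add ((h0 x).mul ((dP1 x hx).mul hi))).mul hi
  have cH' : ContinuousOn H' (uIcc d 1) := by
    rw [hsub]
    have cinv2 : ContinuousOn (fun x : ℝ => -(x ^ 2)⁻¹) (Icc d 1) :=
      (ContinuousOn.inv₀ (by fun_prop) fun x hx => (pow_pos (hpos x hx) 2).ne').neg
    exact (((k2.mul cP).add (k1.mul (cP1.mul cinv))).add ((k1.mul (cP1.mul cinv)).add
      (k0.mul (((cP2.mul cinv).mul cinv).add (cP1.mul cinv2))))).mul cinv |>.add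
      (((k1.mul cP).add (k0.mul (cP1.mul cinv))).mul cinv2)
  have prodb : ∀ A B : ℝ, |A| ≤ M → |B| ≤ K → |A * B| ≤ M * K := fun A B hA hB => by
    rw [abs_mul]; gcongr
  have hMK : 0 < M * K := by positivity
  have inv1 : ∀ x ∈ Icc d 1, 1 ≤ x⁻¹ := fun x hx => (one_le_inv₀ (hpos x hx)).mpr hx.2
  have bH : ∀ x ∈ Icc d 1, |H x| ≤ 2 * (M * K) * x⁻¹ ^ 2 := fun x hx => by
    have hx' : x ∈ Icc (0:ℝ) 1 := ⟨(hpos x hx).le, hx.2⟩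
    have r := inv1 x hx
    have e : H x = (χ1 x * P x) * x⁻¹ + (χ x * P1 x) * x⁻¹ ^ 2 := by simp only [hH]; ring
    have p1 := prodb _ _ (b1 x hx') (hphi (Real.log x)).1
    have p2 := prodb _ _ (b0 x hx') (hphi (Real.log x)).2.1
    have r2 : x⁻¹ ≤ x⁻¹ ^ 2 := by nlinarith
    have r0 : 0 ≤ x⁻¹ := by linarith
    rw [e]
    calc _ ≤ |χ1 x * P x| * x⁻¹ + |χ x * P1 x| * x⁻¹ ^ 2 := by
          refine (abs_add_le _ _).trans ?_
          rw [abs_mul, abs_mul (χ x * P1 x), abs_of_nonneg r0, abs_of_nonneg (pow_nonneg r0 2)]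
      _ ≤ (M * K) * x⁻¹ ^ 2 + (M * K) * x⁻¹ ^ 2 := by gcongr
      _ = _ := by ring
  have bH' : ∀ x ∈ Icc d 1, |H' x| ≤ 8 * (M * K) * x⁻¹ ^ 3 := fun x hx => by
    have hx' : x ∈ Icc (0:ℝ) 1 := ⟨(hpos x hx).le, hx.2⟩
    have r := inv1 x hx
    have e : H' x = (χ2 x * P x) * x⁻¹ + (2 * (χ1 x * P1 x) - χ1 x * P x) * x⁻¹ ^ 2
        + (χ x * P2 x - 2 * (χ x * P1 x)) * x⁻¹ ^ 3 := by simp only [hH']; rw [← inv_pow]; ring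
    have p1 := prodb _ _ (b2 x hx') (hphi (Real.log x)).1
    have p2 := prodb _ _ (b1 x hx') (hphi (Real.log x)).2.1
    have p3 := prodb _ _ (b1 x hx') (hphi (Real.log x)).1
    have p4 := prodb _ _ (b0 x hx') (hphi (Real.log x)).2.2
    have p5 := prodb _ _ (b0 x hx') (hphi (Real.log x)).2.1
    have r0 : 0 ≤ x⁻¹ := by linarith
    have r3 : x⁻¹ ≤ x⁻¹ ^ 3 := le_self_pow₀ r (by norm_num)
    have r2 : x⁻¹ ^ 2 ≤ x⁻¹ ^ 3 := pow_le_pow_right₀ r (by norm_num)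
    have q2 : |2 * (χ1 x * P1 x) - χ1 x * P x| ≤ 3 * (M * K) := by
      rw [abs_le] at *; constructor <;> linarith
    have q3 : |χ x * P2 x - 2 * (χ x * P1 x)| ≤ 3 * (M * K) := by
      rw [abs_le] at *; constructor <;> linarith
    rw [e]
    calc _ ≤ |χ2 x * P x| * x⁻¹ + |2 * (χ1 x * P1 x) - χ1 x * P x| * x⁻¹ ^ 2 +
            |χ x * P2 x - 2 * (χ x * P1 x)| * x⁻¹ ^ 3 := by
          refine (abs_add_three _ _ _).trans ?_
          rw [abs_mul, abs_mul (2 * (χ1 x * P1 x) - χ1 x * P x), 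
            abs_mul (χ x * P2 x - 2 * (χ x * P1 x)), abs_of_nonneg r0,
            abs_of_nonneg (pow_nonneg r0 2), abs_of_nonneg (pow_nonneg r0 3)]
      _ ≤ (M * K) * x⁻¹ ^ 3 + 3 * (M * K) * x⁻¹ ^ 3 + 3 * (M * K) * x⁻¹ ^ 3 := by gcongr
      _ ≤ _ := by nlinarith [mul_nonneg hMK.le (pow_nonneg r0 3)]
  have dG : ∀ x ∈ uIcc d 1, HasDerivAt (fun x : ℝ => -(4 * (M * K)) * x⁻¹ ^ 2)
      (8 * (M * K) * x⁻¹ ^ 3) x := fun x hx => by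
    have hx := hpos x (hsub ▸ hx)
    have := ((hasDerivAt_inv hx.ne').pow 2).const_mul (-(4 * (M * K)))
    refine HasDerivAt.congr_deriv this ?_
    rw [← inv_pow]; push_cast; ring
  have hBi : IntervalIntegrable (fun x : ℝ => 8 * (M * K) * x⁻¹ ^ 3) volume d 1 := by
    apply ContinuousOn.intervalIntegrable
    rw [hsub]; exact continuousOn_const.mul (cinv.pow 3)
  have hInt := intervalIntegral.integral_eq_sub_of_hasDerivAt dG hBi
  have hsecond := ibp_norm t d 1 ht hd1 H H' _ dH cH' bH' hBi
  rw [hInt] at hsecond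
  have e3 : ∫ l in d..1, ph t l * l * (H l : ℂ) = ∫ l in d..1, ph t l * (F' l : ℂ) := by
    apply intervalIntegral.integral_congr
    intro x hx
    have hx0 : (x:ℂ) ≠ 0 := by exact_mod_cast (hpos x (hsub ▸ hx)).ne'
    have : H x = F' x * x⁻¹ := rfl
    simp only [this]
    push_cast
    field_simp
  rw [e3] at hsecond
  rw [ibp t d 1 ht _ _ dF cF', norm_mul, norm_pref t ht]
  gcongr
  rw [hone]
  have bHd := bH d ⟨le_rfl, hd1⟩
  have bH1 := bH 1 ⟨hd1, le_rfl⟩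
  have r := inv1 d ⟨le_rfl, hd1⟩
  have hsec : ‖∫ l in d..1, ph t l * (F' l : ℂ)‖ ≤ (2 * t)⁻¹ * (20 * (M * K) / d ^ 2) := by
    refine hsecond.trans ?_
    gcongr
    have r2 : 1 ≤ d⁻¹ ^ 2 := one_le_pow₀ r
    rw [div_eq_mul_inv, ← inv_pow]
    simp only [inv_one, one_pow, mul_one] at bH1 ⊢
    nlinarith
  calc _ ≤ ‖ph t d * ((χ d * phi c m (Real.log d) : ℝ) : ℂ)‖
        + ‖∫ l in d..1, ph t l * (F' l : ℂ)‖ := by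
        refine (norm_sub_le _ _).trans (add_le_add_left ?_ _)
        simp
    _ ≤ _ := by
        rw [norm_mul, norm_ph, one_mul, Complex.norm_real, Real.norm_eq_abs]
        linarith

/-- The middle part `[ε,δ]`, where the cutoff is one. -/
lemma middle (c : ℝ) {m : ℝ} (hm : 0 < m) (t e d : ℝ) (ht : 0 < t) (he : 0 < e) (hed : e ≤ d)
    (hd : Real.log d + c ≤ 0) :
    ‖∫ l in e..d, ph t l * l * ((phi c m (Real.log l) : ℝ) : ℂ)‖ ≤ phi c m (Real.log d) / t := by
  have hsub : uIcc e d = Icc e d := uIcc_of_le hed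
  have hpos : ∀ x ∈ Icc e d, 0 < x := fun x hx => lt_of_lt_of_le he hx.1
  have clog : ContinuousOn Real.log (Icc e d) :=
    Real.continuousOn_log.mono fun x hx => (hpos x hx).ne'
  have cinv : ContinuousOn (fun x : ℝ => x⁻¹) (Icc e d) :=
    continuousOn_inv₀.mono fun x hx => (hpos x hx).ne'
  have cP1 : ContinuousOn (fun l => phi1 c m (Real.log l) * l⁻¹) (uIcc e d) := by
    rw [hsub]; exact ((phi1_cont c hm).comp_continuousOn clog).mul cinv
  have dP : ∀ x ∈ uIcc e d, HasDerivAt (fun l => phi c m (Real.log l))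
      (phi1 c m (Real.log x) * x⁻¹) x := fun x hx =>
    (phi_deriv c (Real.log x) hm).comp x (Real.hasDerivAt_log (hpos x (hsub ▸ hx)).ne')
  have h := ibp_norm t e d ht hed _ _ (fun l => phi1 c m (Real.log l) * l⁻¹) dP cP1 (fun x hx => by
    rw [abs_of_nonneg]
    have hx0 := hpos x hx
    have : Real.log x ≤ Real.log d := Real.log_le_log hx0 hx.2
    exact mul_nonneg (phi1_nonneg c (by linarith)) (by positivity)) cP1.intervalIntegrable
  rw [intervalIntegral.integral_eq_sub_of_hasDerivAt dP cP1.intervalIntegrable,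
    abs_of_nonneg (phi_nonneg _ _ hm), abs_of_nonneg (phi_nonneg _ _ hm)] at h
  refine h.trans (le_of_eq ?_)
  field_simp; ring

set_option maxHeartbeats 2000000 in
lemma main_bound (c : ℝ) {m : ℝ} (hm : 0 < m) (lam : ℝ) (hl0 : 0 < lam) (hl1 : lam < 1 / 2)
    (hlc : Real.log lam + c ≤ 0) (χ : ℝ → ℝ) (hχ : ContDiff ℝ (⊤ : ℕ∞) χ)
    (hb : ∀ s, 0 ≤ χ s ∧ χ s ≤ 1) (hs : Function.support χ ⊆ Icc (-lam) lam)
    (hone : ∀ s ∈ Icc (-lam/2) (lam/2), χ s = 1) :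
    ∃ K : ℝ, 0 < K ∧ ∀ t : ℝ, 2 < t →
      ‖∫ l in Ioi (0:ℝ), ph t l * l * ((χ l * phi c m (Real.log l) : ℝ) : ℂ)‖ ≤
        K / (t * Real.log t ^ 2) := by
  have hz : ∀ x, 1 ≤ x → χ x = 0 := fun x hx => by
    by_contra hne
    have := (hs (Function.mem_support.mpr hne)).2
    linarith
  have hχ1 : ContDiff ℝ (⊤ : ℕ∞) (deriv χ) := (contDiff_infty_iff_deriv.mp hχ).2
  have hχ2 : ContDiff ℝ (⊤ : ℕ∞) (deriv (deriv χ)) := (contDiff_infty_iff_deriv.mp hχ1).2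
  have d0 : ∀ x, HasDerivAt χ (deriv χ x) x := fun x =>
    ((contDiff_infty_iff_deriv.mp hχ).1 x).hasDerivAt
  have d1 : ∀ x, HasDerivAt (deriv χ) (deriv (deriv χ) x) x := fun x =>
    ((contDiff_infty_iff_deriv.mp hχ1).1 x).hasDerivAt
  obtain ⟨K, hK, hout⟩ := outer c hm χ _ _ d0 d1 hχ2.continuous (hz 1 le_rfl)
  obtain ⟨Kd, hKd, hdec⟩ := phi_decay c hm
  obtain ⟨Kb, hKb, hbd⟩ := phi_bdd c hm
  refine ⟨48 * Kd + 16 * K / lam ^ 2, by positivity, fun t ht => ?_⟩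
  have ht0 : 0 < t := by linarith
  have hLt : 0 < Real.log t := Real.log_pos (by linarith)
  set s := t ^ (-(1/4) : ℝ) with hsdef
  have hs0 : 0 < s := by positivity
  have hs1 : s ≤ 1 := Real.rpow_le_one_of_one_le_of_nonpos (by linarith) (by norm_num)
  have hs4 : s ^ 4 = t⁻¹ := by
    rw [hsdef, ← Real.rpow_natCast, ← Real.rpow_mul ht0.le]; norm_num
    rw [Real.rpow_neg_one]
  set d := lam / 2 * s with hd
  set e := lam / 2 * s ^ 2 with he
  have hd0 : 0 < d := by positivity
  have he0 : 0 < e := by positivity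
  have hed : e ≤ d := by
    rw [hd, he]; gcongr; nlinarith
  have hdl : d ≤ lam / 2 := by rw [hd]; nlinarith
  have hd1 : d ≤ 1 := by linarith
  have hlogs : Real.log s = -(1/4) * Real.log t := by rw [hsdef, Real.log_rpow ht0]
  have hlogd : Real.log d ≤ -(1/4) * Real.log t := by
    rw [hd, Real.log_mul (by positivity) hs0.ne', hlogs]
    have : Real.log (lam / 2) ≤ 0 := Real.log_nonpos (by positivity) (by linarith)
    linarith
  have hdc : Real.log d + c ≤ 0 := by
    have : Real.log d ≤ Real.log lam := Real.log_le_log hd0 (by linarith)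
    linarith
  have hg : phi c m (Real.log d) ≤ 16 * Kd / Real.log t ^ 2 := by
    refine (hdec _ (by nlinarith)).trans ?_
    rw [div_le_div_iff₀ (by nlinarith) (by positivity)]
    have : (Real.log t) ^ 2 ≤ 16 * Real.log d ^ 2 := by nlinarith
    nlinarith
  set g := phi c m (Real.log d) with hgdef
  have hg0 : 0 ≤ g := phi_nonneg _ _ hm
  -- the integrand
  set f : ℝ → ℂ := fun l => ph t l * l * ((χ l * phi c m (Real.log l) : ℝ) : ℂ) with hf
  have hmeas : Measurable f := by
    have m1 := (continuous_ph t).measurable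
    have m2 := hχ.continuous.measurable
    have m3 : Measurable fun l => phi c m (Real.log l) :=
      (phi_cont c hm).measurable.comp Real.measurable_log
    exact (m1.mul Complex.measurable_ofReal).mul (Complex.measurable_ofReal.comp (m2.mul m3))
  have hfb : ∀ l ∈ Ioc (0:ℝ) 1, ‖f l‖ ≤ Kb := fun l hl => by
    simp only [hf]
    rw [norm_mul, norm_mul, norm_ph, Complex.norm_real, Complex.norm_real, Real.norm_eq_abs,
      Real.norm_eq_abs, abs_of_pos hl.1, abs_mul, abs_of_nonneg (hb l).1]
    have h1 := (hbd (Real.log l)).1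
    have h2 : χ l * |phi c m (Real.log l)| ≤ 1 * Kb :=
      mul_le_mul (hb l).2 h1 (abs_nonneg _) zero_le_one
    have h3 : 0 ≤ χ l * |phi c m (Real.log l)| := mul_nonneg (hb l).1 (abs_nonneg _)
    nlinarith [hl.1, hl.2]
  have hInt : IntervalIntegrable f volume 0 1 := by
    rw [intervalIntegrable_iff_integrableOn_Ioc_of_le zero_le_one]
    refine Measure.integrableOn_of_bounded (M := Kb) (by simp) hmeas.aestronglyMeasurable ?_
    exact (ae_restrict_iff' measurableSet_Ioc).mpr (Filter.Eventually.of_forall hfb)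
  have i1 : IntervalIntegrable f volume 0 e := hInt.mono_set (by
    rw [uIcc_of_le he0.le, uIcc_of_le zero_le_one]; exact Icc_subset_Icc le_rfl (by linarith))
  have i2 : IntervalIntegrable f volume e d := hInt.mono_set (by
    rw [uIcc_of_le hed, uIcc_of_le zero_le_one]; exact Icc_subset_Icc he0.le hd1)
  have i3 : IntervalIntegrable f volume d 1 := hInt.mono_set (by
    rw [uIcc_of_le hd1, uIcc_of_le zero_le_one]; exact Icc_subset_Icc hd0.le le_rfl)
  have hsplit : ∫ l in Ioi (0:ℝ), f l =
      (∫ l in 0..e, f l) + (∫ l in e..d, f l) + ∫ l in d..1, f l := by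
    rw [intervalIntegral.integral_add_adjacent_intervals i1 i2,
      intervalIntegral.integral_add_adjacent_intervals (i1.trans i2) i3,
      intervalIntegral.integral_of_le zero_le_one]
    apply setIntegral_eq_of_subset_of_forall_sdiff_eq_zero measurableSet_Ioi
      (fun x hx => hx.1)
    intro x hx
    have : 1 ≤ x := by
      by_contra h
      exact hx.2 ⟨hx.1, by linarith⟩
    simp [hf, hz x this]
  have B1 : ‖∫ l in 0..e, f l‖ ≤ g / t := by
    have h := intervalIntegral.norm_integral_le_of_norm_le_const (a := 0) (b := e) (f := f)
      (C := e * g) (fun l hl => by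
        rw [uIoc_of_le he0.le] at hl
        simp only [hf]
        rw [norm_mul, norm_mul, norm_ph, Complex.norm_real, Complex.norm_real, Real.norm_eq_abs,
          Real.norm_eq_abs, abs_of_pos hl.1, abs_mul, abs_of_nonneg (hb l).1,
          abs_of_nonneg (phi_nonneg _ _ hm), one_mul]
        have h1 : phi c m (Real.log l) ≤ g :=
          phi_mono c hm (Real.log_le_log hl.1 (hl.2.trans hed)) hdc
        have h2 : χ l * phi c m (Real.log l) ≤ 1 * g :=
          mul_le_mul (hb l).2 h1 (phi_nonneg _ _ hm) zero_le_one
        rw [one_mul] at h2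
        exact mul_le_mul hl.2 h2 (mul_nonneg (hb l).1 (phi_nonneg _ _ hm)) he0.le)
    refine h.trans ?_
    rw [sub_zero, abs_of_pos he0]
    have : e * e ≤ t⁻¹ := by
      have : e * e = (lam / 2) ^ 2 * s ^ 4 := by rw [he]; ring
      rw [this, hs4]
      have : (lam / 2) ^ 2 ≤ 1 := by nlinarith
      nlinarith [inv_pos.mpr ht0]
    rw [div_eq_mul_inv]
    calc e * g * e = g * (e * e) := by ring
      _ ≤ g * t⁻¹ := mul_le_mul_of_nonneg_left this hg0
  have B2 : ‖∫ l in e..d, f l‖ ≤ g / t := by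
    have : ∫ l in e..d, f l = ∫ l in e..d, ph t l * l * ((phi c m (Real.log l) : ℝ) : ℂ) := by
      apply intervalIntegral.integral_congr
      intro l hl
      rw [uIcc_of_le hed] at hl
      have h1 : χ l = 1 := hone l ⟨by linarith [hl.1], by linarith [hl.2]⟩
      simp only [hf, h1, one_mul]
    rw [this]
    exact middle c hm t e d ht0 he0 hed hdc
  have B3 := hout t d ht0 hd0 hd1
  have hχd : χ d = 1 := hone d ⟨by linarith, hdl⟩
  rw [hχd, one_mul, abs_of_nonneg hg0] at B3
  have hlogt : Real.log t ^ 2 * s ^ 2 ≤ 16 := by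
    have h1 : Real.log t ≤ t ^ (1/4 : ℝ) / (1/4) := Real.log_le_rpow_div ht0.le (by norm_num)
    have h2 : t ^ (1/4 : ℝ) * s = 1 := by
      rw [hsdef, ← Real.rpow_add ht0]; norm_num
    have h3 : Real.log t * s ≤ 4 := by nlinarith
    have h4 : 0 ≤ Real.log t * s := by positivity
    nlinarith
  have htd : t⁻¹ * (K / d ^ 2) ≤ 64 * K / lam ^ 2 / Real.log t ^ 2 := by
    have : t⁻¹ * (K / d ^ 2) = 4 * K / lam ^ 2 * s ^ 2 := by
      rw [← hs4, hd]; field_simp; ring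
    rw [this, le_div_iff₀ (by positivity)]
    have : 0 ≤ 4 * K / lam ^ 2 := by positivity
    calc _ = 4 * K / lam ^ 2 * (Real.log t ^ 2 * s ^ 2) := by ring
      _ ≤ 4 * K / lam ^ 2 * 16 := by gcongr
      _ = _ := by ring
  have B3' : ‖∫ l in d..1, f l‖ ≤ t⁻¹ * (g + 16 * K / lam ^ 2 / Real.log t ^ 2) := by
    refine B3.trans ?_
    have : (2 * t)⁻¹ = t⁻¹ / 2 := by field_simp
    rw [this]
    have hti : 0 < t⁻¹ := inv_pos.mpr ht0
    have e2 : 64 * K / lam ^ 2 / Real.log t ^ 2 = 4 * (16 * K / lam ^ 2 / Real.log t ^ 2) := by ring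
    have : g + t⁻¹ / 2 * (K / d ^ 2) ≤ 2 * (g + 16 * K / lam ^ 2 / Real.log t ^ 2) := by
      linarith
    nlinarith
  rw [hsplit]
  calc _ ≤ ‖∫ l in 0..e, f l‖ + ‖∫ l in e..d, f l‖ + ‖∫ l in d..1, f l‖ := norm_add₃_le
    _ ≤ g / t + g / t + t⁻¹ * (g + 16 * K / lam ^ 2 / Real.log t ^ 2) := by gcongr
    _ = t⁻¹ * (3 * g + 16 * K / lam ^ 2 / Real.log t ^ 2) := by ring
    _ ≤ t⁻¹ * (3 * (16 * Kd / Real.log t ^ 2) + 16 * K / lam ^ 2 / Real.log t ^ 2) := by gcongr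
    _ = _ := by field_simp; ring

/-- Lemma 4.4 of the paper. -/
theorem stmt3 (c₁ c₂ a b a' b' : ℝ) (hc₂ : c₂ ≠ 0) :
    ∃ lam₁ ∈ Ioo (0:ℝ) (1/2),
      ∀ χ : ℝ → ℝ, ContDiff ℝ (⊤ : ℕ∞) χ → (∀ s, 0 ≤ χ s ∧ χ s ≤ 1) →
        Function.support χ ⊆ Icc (-lam₁) lam₁ →
        (∀ s ∈ Icc (-lam₁/2) (lam₁/2), χ s = 1) →
        ∃ C' : ℝ, ∀ t : ℝ, 2 < t → ∀ x x₁ y y₁ : EuclideanSpace ℝ (Fin 2),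
          x ≠ x₁ → y ≠ y₁ →
          ‖∫ l in Ioi (0:ℝ), Complex.exp (Complex.I * (t:ℂ) * (l:ℂ) ^ 2) * (l:ℂ) * (χ l : ℂ)
              * (((a * Real.log ‖x - x₁‖ + b) * (a' * Real.log ‖y - y₁‖ + b')
                  / ((Real.log l + c₁) ^ 2 + c₂ ^ 2) : ℝ) : ℂ)‖
            ≤ C' * kker x x₁ * kker y y₁ * Real.sqrt (wwt x * wwt y)
                / (t * Real.log t ^ 2) := by
  have hm : 0 < c₂ ^ 2 := by positivity
  set lam := min (1/4) (Real.exp (-c₁)) with hlam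
  have hl0 : 0 < lam := lt_min (by norm_num) (Real.exp_pos _)
  have hl1 : lam < 1 / 2 := lt_of_le_of_lt (min_le_left _ _) (by norm_num)
  have hlc : Real.log lam + c₁ ≤ 0 := by
    have := Real.log_le_log hl0 (min_le_right (1/4) (Real.exp (-c₁)))
    rw [Real.log_exp] at this
    linarith
  refine ⟨lam, ⟨hl0, hl1⟩, fun χ hχ hb hs hone => ?_⟩
  obtain ⟨K, hK, hmain⟩ := main_bound c₁ hm lam hl0 hl1 hlc χ hχ hb hs hone
  refine ⟨((|a| + |b|) * 3) * ((|a'| + |b'|) * 3) * K, fun t ht x x₁ y y₁ hx hy => ?_⟩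
  have hA := kernel_bound a b x x₁ hx
  have hB := kernel_bound a' b' y y₁ hy
  set A := a * Real.log ‖x - x₁‖ + b
  set B := a' * Real.log ‖y - y₁‖ + b'
  have e1 : ∫ l in Ioi (0:ℝ), Complex.exp (Complex.I * (t:ℂ) * (l:ℂ) ^ 2) * (l:ℂ) * (χ l : ℂ)
              * ((A * B / ((Real.log l + c₁) ^ 2 + c₂ ^ 2) : ℝ) : ℂ) =
      ((A * B : ℝ) : ℂ) *
        ∫ l in Ioi (0:ℝ), ph t l * l * ((χ l * phi c₁ (c₂ ^ 2) (Real.log l) : ℝ) : ℂ) := by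
    rw [← integral_const_mul]
    congr 1; ext l
    simp only [ph, phi]
    push_cast
    ring
  have hLx := half_le_L x
  have hLy := half_le_L y
  have hw : Real.sqrt (wwt x * wwt y) = Real.log (2 + ‖x‖) * Real.log (2 + ‖y‖) := by
    unfold wwt
    rw [← mul_pow, Real.sqrt_sq (by positivity)]
  rw [e1, norm_mul, Complex.norm_real, Real.norm_eq_abs, abs_mul, hw]
  have hkx := kker_one_le x x₁
  have hky := kker_one_le y y₁
  calc _ ≤ ((|a| + |b|) * 3 * (kker x x₁ * Real.log (2 + ‖x‖))) *
        ((|a'| + |b'|) * 3 * (kker y y₁ * Real.log (2 + ‖y‖))) * (K / (t * Real.log t ^ 2)) := by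
        gcongr
        exact hmain t ht
    _ = _ := by ring
end
end

section
/- There is an absolute constant C such that for every t > 100, (1/t²) ∫_{t^{-1/2}}^{1/10} 1/(λ³ |log λ|³) dλ ≤ C ( t^{-3/2} + 1/(t (log t)³) ). -/
open MeasureTheory Set

noncomputable section

lemma aux_pt (s l : ℝ) (hs : 1 < s) (hl0 : 0 < l) (hl1 : l < 1/10) :
    1 / (l ^ 3 * |Real.log l| ^ 3) ≤ 64 / (12 * Real.log s) ^ 3 * l ^ (-3 : ℤ) + 8 * s ^ 9 := by
  have hs0 : 0 < s := by linarith
  have hL : 0 < Real.log s := Real.log_pos hs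
  have hz : l ^ (-3 : ℤ) = 1 / l ^ 3 := by
    rw [zpow_neg, one_div]; norm_cast
  have hl3 : 0 < l ^ 3 := by positivity
  have hneg : Real.log l ≤ l - 1 := Real.log_le_sub_one_of_pos hl0
  have habs : |Real.log l| = - Real.log l := abs_of_neg (by linarith)
  rw [hz]
  rcases le_total (l * s ^ 3) 1 with h | h
  · have h1 : Real.log (l * s ^ 3) ≤ 0 := Real.log_nonpos (by positivity) h
    rw [Real.log_mul hl0.ne' (by positivity), Real.log_pow] at h1
    push_cast at h1
    have h2 : 3 * Real.log s ≤ |Real.log l| := by rw [habs]; linarith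
    have h3 : 1 / (l ^ 3 * |Real.log l| ^ 3) ≤ 1 / (l ^ 3 * (3 * Real.log s) ^ 3) := by
      gcongr
    have h4 : 1 / (l ^ 3 * (3 * Real.log s) ^ 3) = 64 / (12 * Real.log s) ^ 3 * (1 / l ^ 3) := by
      field_simp
      norm_num
    have : 0 ≤ 8 * s ^ 9 := by positivity
    linarith
  · have h2 : (1/2 : ℝ) ≤ |Real.log l| := by rw [habs]; linarith
    have h3 : 1 / (l ^ 3 * |Real.log l| ^ 3) ≤ 1 / (l ^ 3 * (1/2) ^ 3) := by
      gcongr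
    have h4 : 1 / (l ^ 3 * (1/2) ^ 3) ≤ 8 * s ^ 9 := by
      rw [div_le_iff₀ (by positivity)]
      have : 1 ≤ (l * s ^ 3) ^ 3 := one_le_pow₀ h
      nlinarith
    have : 0 ≤ 64 / (12 * Real.log s) ^ 3 * (1 / l ^ 3) := by positivity
    linarith

lemma aux_int (s : ℝ) (hs : 1 < s) (h : (s ^ 6)⁻¹ ≤ 1/10) :
    ∫ l in Ioo ((s ^ 6)⁻¹) (1/10), 1 / (l ^ 3 * |Real.log l| ^ 3)
      ≤ 64 / (12 * Real.log s) ^ 3 * (s ^ 12 / 2) + s ^ 9 := by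
  have hs0 : 0 < s := by linarith
  have hL : 0 < Real.log s := Real.log_pos hs
  have ha : 0 < (s ^ 6)⁻¹ := by positivity
  have h0 : (0:ℝ) ∉ uIcc ((s ^ 6)⁻¹) (1/10) := by
    rw [uIcc_of_le h]; intro hh; linarith [hh.1]
  have hi1 : IntervalIntegrable (fun l : ℝ => 64 / (12 * Real.log s) ^ 3 * l ^ (-3 : ℤ)) volume
      ((s ^ 6)⁻¹) (1/10) :=
    (intervalIntegral.intervalIntegrable_zpow (Or.inr h0)).const_mul _
  have hi2 : IntervalIntegrable (fun _ : ℝ => 8 * s ^ 9) volume ((s ^ 6)⁻¹) (1/10) :=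
    intervalIntegrable_const
  have hi := hi1.add hi2
  have hint := (intervalIntegrable_iff_integrableOn_Ioo_of_le h).1 hi
  have hle : ∫ l in Ioo ((s ^ 6)⁻¹) (1/10), 1 / (l ^ 3 * |Real.log l| ^ 3) ≤
      ∫ l in Ioo ((s ^ 6)⁻¹) (1/10), (64 / (12 * Real.log s) ^ 3 * l ^ (-3 : ℤ) + 8 * s ^ 9) := by
    apply integral_mono_of_nonneg
    · filter_upwards [ae_restrict_mem measurableSet_Ioo] with l hl
      have : 0 < l := ha.trans hl.1
      simp only [Pi.zero_apply]
      positivity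
    · exact hint
    · filter_upwards [ae_restrict_mem measurableSet_Ioo] with l hl
      exact aux_pt s l hs (ha.trans hl.1) hl.2
  refine hle.trans ?_
  rw [← integral_Ioc_eq_integral_Ioo, ← intervalIntegral.integral_of_le h,
    intervalIntegral.integral_add hi1 hi2, intervalIntegral.integral_const_mul,
    integral_zpow (Or.inr ⟨by norm_num, h0⟩), intervalIntegral.integral_const]
  have e : ((s ^ 6)⁻¹ : ℝ) ^ ((-3 : ℤ) + 1) = s ^ 12 := by
    rw [show (-3 : ℤ) + 1 = -2 by norm_num, zpow_neg, ← inv_zpow, inv_inv]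
    norm_cast
    ring
  rw [e]
  gcongr ?_ * ?_ + ?_
  · norm_num
    linarith
  · rw [smul_eq_mul]
    have : 0 < s ^ 9 := by positivity
    nlinarith

/-- An estimate from the proof of Lemma 4.4 of the paper. -/
theorem stmt5 :
    ∃ C : ℝ, 0 < C ∧ ∀ t : ℝ, 100 < t →
      (1 / t ^ 2) * ∫ l in Ioo (t ^ (-(1/2) : ℝ)) (1/10), 1 / (l ^ 3 * |Real.log l| ^ 3)
        ≤ C * (t ^ ((-3 : ℝ)/2) + 1 / (t * Real.log t ^ 3)) := by
  refine ⟨2000, by norm_num, fun t ht => ?_⟩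
  have ht0 : 0 < t := by linarith
  obtain ⟨s, hs, hst⟩ : ∃ s : ℝ, 1 < s ∧ t = s ^ 12 := by
    refine ⟨t ^ (1/12 : ℝ), Real.one_lt_rpow (by linarith) (by norm_num), ?_⟩
    rw [← Real.rpow_natCast, ← Real.rpow_mul ht0.le]
    norm_num
  have hs0 : 0 < s := by linarith
  have hL : 0 < Real.log s := Real.log_pos hs
  have e1 : t ^ (-(1/2) : ℝ) = (s ^ 6)⁻¹ := by
    rw [hst, ← Real.rpow_natCast, ← Real.rpow_mul hs0.le, ← Real.rpow_natCast,
      ← Real.rpow_neg hs0.le]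
    norm_num
  have h10 : (10 : ℝ) ≤ s ^ 6 := by
    have : (0:ℝ) < s ^ 6 := by positivity
    nlinarith
  have h : (s ^ 6)⁻¹ ≤ 1/10 := by
    rw [one_div]; gcongr
  have e2 : Real.log t = 12 * Real.log s := by rw [hst, Real.log_pow]; norm_num
  have hp : 0 ≤ t ^ ((-3 : ℝ)/2) := by positivity
  rw [e1, e2]
  have hls : Real.log s ≤ s := by linarith [Real.log_le_sub_one_of_pos hs0]
  have hl3 : Real.log s ^ 3 ≤ s ^ 3 := by gcongr
  have key := aux_int s hs h
  have k2 : s ^ 9 ≤ 1728 / (12 * Real.log s) ^ 3 * s ^ 12 := by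
    rw [div_mul_eq_mul_div, le_div_iff₀ (by positivity)]
    have : 0 < s ^ 9 := by positivity
    nlinarith
  calc _ ≤ (1 / t ^ 2) * (1760 / (12 * Real.log s) ^ 3 * s ^ 12) := by
        gcongr
        refine key.trans ?_
        have : 64 / (12 * Real.log s) ^ 3 * (s ^ 12 / 2) + 1728 / (12 * Real.log s) ^ 3 * s ^ 12
          = 1760 / (12 * Real.log s) ^ 3 * s ^ 12 := by ring
        linarith
    _ = 1760 * (1 / (t * (12 * Real.log s) ^ 3)) := by
        rw [← hst]; field_simp
    _ ≤ _ := by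
        have : 0 ≤ 1 / (t * (12 * Real.log s) ^ 3) := by positivity
        linarith
end
end

section
/- Let k ∈ {0, 1, 2} and let σ > k + 1/2 be a real number. There is a constant C (depending on k and σ) such that for every x ∈ ℝ², ∫_{ℝ²} |x−y|^{2k−1} (1+|y|²)^{−σ} dy ≤ C (1+|x|²)^{max(0, k−1/2)}. -/
open MeasureTheory

noncomputable section

theorem aux_bracket_integrable {τ : ℝ} (hτ : 1 < τ) :
    Integrable (fun y : EuclideanSpace ℝ (Fin 2) => (1 + ‖y‖ ^ 2) ^ (-τ)) := by
  have h := integrable_rpow_neg_one_add_norm_sq (E := EuclideanSpace ℝ (Fin 2))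
    (μ := volume) (r := 2 * τ) (by simp; linarith)
  have e : -(2 * τ) / 2 = -τ := by ring
  rwa [e] at h

theorem aux_sing_integrable :
    Integrable ((Metric.ball (0 : EuclideanSpace ℝ (Fin 2)) 1).indicator
      (fun z => ‖z‖ ^ (-1 : ℝ))) := by
  rw [integrable_indicator_iff measurableSet_ball]
  refine (integrableOn_fun_norm_addHaar (E := EuclideanSpace ℝ (Fin 2)) volume
    (f := fun t : ℝ => t ^ (-1 : ℝ)) (r := 1)).2 ?_
  have : IntegrableOn (fun _ : ℝ => (1 : ℝ)) (Set.Ioo 0 1) := by simp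
  refine this.congr_fun ?_ measurableSet_Ioo
  intro t ht
  have : t ≠ 0 := ht.1.ne'
  simp [Real.rpow_neg_one, this]

theorem aux_zero {σ : ℝ} (hσ : 1 / 2 < σ) (x y : EuclideanSpace ℝ (Fin 2)) :
    ‖x - y‖ ^ (-1 : ℝ) * (1 + ‖y‖ ^ 2) ^ (-σ) ≤
      ((Metric.ball (0 : EuclideanSpace ℝ (Fin 2)) 1).indicator
        (fun z => ‖z‖ ^ (-1 : ℝ)) (x - y) + 2 * (1 + ‖x - y‖ ^ 2) ^ (-(σ + 1 / 2)))
      + 2 * (1 + ‖y‖ ^ 2) ^ (-(σ + 1 / 2)) := by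
  have hB1 : 1 ≤ 1 + ‖y‖ ^ 2 := by nlinarith [sq_nonneg ‖y‖]
  have hA1 : 1 ≤ 1 + ‖x - y‖ ^ 2 := by nlinarith [sq_nonneg ‖x - y‖]
  by_cases h : ‖x - y‖ < 1
  · have hm : x - y ∈ Metric.ball (0 : EuclideanSpace ℝ (Fin 2)) 1 := by simpa using h
    rw [Set.indicator_of_mem hm]
    have h1 : (1 + ‖y‖ ^ 2) ^ (-σ) ≤ 1 :=
      Real.rpow_le_one_of_one_le_of_nonpos hB1 (by linarith)
    have h2 := mul_le_mul_of_nonneg_left h1 (Real.rpow_nonneg (norm_nonneg (x - y)) (-1))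
    have h3 : 0 ≤ (1 + ‖x - y‖ ^ 2) ^ (-(σ + 1 / 2)) := by positivity
    have h4 : 0 ≤ (1 + ‖y‖ ^ 2) ^ (-(σ + 1 / 2)) := by positivity
    linarith
  · have hm : x - y ∉ Metric.ball (0 : EuclideanSpace ℝ (Fin 2)) 1 := by simpa using h
    rw [Set.indicator_of_notMem hm]
    push Not at h
    generalize ‖x - y‖ = a at *
    set A := 1 + a ^ 2 with hA
    set B := 1 + ‖y‖ ^ 2 with hB
    have hA0 : 0 < A := by linarith
    have hB0 : 0 < B := by linarith
    have h1 : a ^ (-1 : ℝ) ≤ 2 * A ^ (-(1 / 2) : ℝ) := by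
      have e : (2 * a) ^ (-1 : ℝ) ≤ A ^ (-(1 / 2) : ℝ) := by
        have e2 : (2 * a) ^ (-1 : ℝ) = ((2 * a) ^ 2) ^ (-(1 / 2) : ℝ) := by
          rw [← Real.rpow_natCast, ← Real.rpow_mul (by positivity)]
          norm_num
        rw [e2]
        exact Real.rpow_le_rpow_of_nonpos hA0 (by nlinarith) (by norm_num)
      rw [Real.mul_rpow (by norm_num) (by linarith), Real.rpow_neg_one 2] at e
      linarith
    have h2 : A ^ (-(1 / 2) : ℝ) * B ^ (-σ) ≤ A ^ (-(σ + 1 / 2)) + B ^ (-(σ + 1 / 2)) := by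
      have hpA : 0 ≤ A ^ (-(σ + 1 / 2)) := by positivity
      have hpB : 0 ≤ B ^ (-(σ + 1 / 2)) := by positivity
      rcases le_total A B with hab | hab
      · have := Real.rpow_le_rpow_of_nonpos hA0 hab (z := -σ) (by linarith)
        have h5 := mul_le_mul_of_nonneg_left this (Real.rpow_nonneg hA0.le (-(1 / 2)))
        rw [← Real.rpow_add hA0] at h5
        have e : -(1 / 2) + -σ = -(σ + 1 / 2) := by ring
        rw [e] at h5
        linarith
      · have := Real.rpow_le_rpow_of_nonpos hB0 hab (z := -(1 / 2)) (by norm_num)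
        have h5 := mul_le_mul_of_nonneg_right this (Real.rpow_nonneg hB0.le (-σ))
        rw [← Real.rpow_add hB0] at h5
        have e : -(1 / 2) + -σ = -(σ + 1 / 2) := by ring
        rw [e] at h5
        linarith
    have h3 := mul_le_mul_of_nonneg_right h1 (Real.rpow_nonneg hB0.le (-σ))
    nlinarith

theorem aux_pos {k σ : ℝ} (hk : 1 ≤ k) (x y : EuclideanSpace ℝ (Fin 2)) :
    ‖x - y‖ ^ (2 * k - 1) * (1 + ‖y‖ ^ 2) ^ (-σ) ≤
      (1 + ‖x‖ ^ 2) ^ (k - 1 / 2) * (1 + ‖y‖ ^ 2) ^ (-(σ - (k - 1 / 2))) := by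
  have hB0 : 0 < 1 + ‖y‖ ^ 2 := by positivity
  have hA0 : 0 < 1 + ‖x‖ ^ 2 := by positivity
  have h1 : ‖x - y‖ ^ 2 ≤ (1 + ‖x‖ ^ 2) * (1 + ‖y‖ ^ 2) := by
    have := norm_sub_le x y
    have h2 : ‖x - y‖ ^ 2 ≤ (‖x‖ + ‖y‖) ^ 2 := by gcongr
    nlinarith [sq_nonneg (1 - ‖x‖ * ‖y‖)]
  have e : ‖x - y‖ ^ (2 * k - 1) = (‖x - y‖ ^ 2) ^ (k - 1 / 2) := by
    rw [← Real.rpow_natCast, ← Real.rpow_mul (norm_nonneg _)]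
    congr 1
    push_cast
    ring
  have e2 : -(σ - (k - 1 / 2)) = (k - 1 / 2) + -σ := by ring
  rw [e, e2, Real.rpow_add hB0, ← mul_assoc, ← Real.mul_rpow hA0.le hB0.le]
  have h3 : 0 ≤ k - 1 / 2 := by linarith
  gcongr

/-- Estimate (5.9) of the paper: weighted `L²` bounds for derivatives of the
free resolvent kernel. -/
theorem stmt10 (k : ℕ) (hk : k ≤ 2) (σ : ℝ) (hσ : (k : ℝ) + 1/2 < σ) :
    ∃ C : ℝ, 0 < C ∧ ∀ x : EuclideanSpace ℝ (Fin 2),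
      (∫⁻ y : EuclideanSpace ℝ (Fin 2),
          ENNReal.ofReal (‖x - y‖ ^ (2 * (k:ℝ) - 1) * (1 + ‖y‖ ^ 2) ^ (-σ)))
        ≤ ENNReal.ofReal (C * (1 + ‖x‖ ^ 2) ^ (max 0 ((k:ℝ) - 1/2))) := by
  rcases Nat.eq_zero_or_pos k with rfl | hpos
  · have hσ' : 1 / 2 < σ := by simpa using hσ
    have hb := (aux_bracket_integrable (τ := σ + 1 / 2) (by linarith)).const_mul 2
    have hg := aux_sing_integrable.add hb
    set g : EuclideanSpace ℝ (Fin 2) → ℝ := fun z =>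
      (Metric.ball (0 : EuclideanSpace ℝ (Fin 2)) 1).indicator
        (fun z => ‖z‖ ^ (-1 : ℝ)) z + 2 * (1 + ‖z‖ ^ 2) ^ (-(σ + 1 / 2)) with hgdef
    set b : EuclideanSpace ℝ (Fin 2) → ℝ := fun z => 2 * (1 + ‖z‖ ^ 2) ^ (-(σ + 1 / 2)) with hbdef
    replace hg : Integrable g := hg
    have hb0 : ∀ z, 0 ≤ b z := fun z => by simp only [hbdef]; positivity
    have hg0 : ∀ z, 0 ≤ g z := fun z =>
      add_nonneg (Set.indicator_nonneg (fun _ _ => by positivity) z) (hb0 z)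
    have I1 : 0 ≤ ∫ z, g z := integral_nonneg hg0
    have I2 : 0 ≤ ∫ z, b z := integral_nonneg hb0
    refine ⟨(∫ z, g z) + (∫ z, b z) + 1, by linarith, fun x => ?_⟩
    have hgx : Integrable (fun y => g (x - y)) := hg.comp_sub_left x
    calc _ ≤ ∫⁻ y, ENNReal.ofReal (g (x - y) + b y) := by
          refine lintegral_mono fun y => ENNReal.ofReal_le_ofReal ?_
          have e : 2 * ((0 : ℕ) : ℝ) - 1 = -1 := by norm_num
          rw [e]
          exact aux_zero hσ' x y
      _ = ENNReal.ofReal (∫ y, (g (x - y) + b y)) := by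
          exact (ofReal_integral_eq_lintegral_ofReal (hgx.add hb)
            (Filter.Eventually.of_forall fun y => add_nonneg (hg0 _) (hb0 _))).symm
      _ ≤ _ := by
          rw [integral_add hgx hb, integral_sub_left_eq_self g volume x]
          apply ENNReal.ofReal_le_ofReal
          have : max 0 (((0 : ℕ) : ℝ) - 1 / 2) = 0 := by norm_num
          rw [this, Real.rpow_zero]
          linarith
  · have hk1 : (1 : ℝ) ≤ k := by exact_mod_cast hpos
    have hb := aux_bracket_integrable (τ := σ - (k - 1 / 2)) (by linarith)
    set b : EuclideanSpace ℝ (Fin 2) → ℝ :=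
      fun z => (1 + ‖z‖ ^ 2) ^ (-(σ - (k - 1 / 2))) with hbdef
    have hb0 : ∀ z, 0 ≤ b z := fun z => by simp only [hbdef]; positivity
    have I2 : 0 ≤ ∫ z, b z := integral_nonneg hb0
    refine ⟨(∫ z, b z) + 1, by linarith, fun x => ?_⟩
    have hx0 : 0 ≤ (1 + ‖x‖ ^ 2) ^ ((k : ℝ) - 1 / 2) := by positivity
    calc _ ≤ ∫⁻ y, ENNReal.ofReal ((1 + ‖x‖ ^ 2) ^ ((k : ℝ) - 1 / 2) * b y) :=
          lintegral_mono fun y => ENNReal.ofReal_le_ofReal (aux_pos hk1 x y)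
      _ = ENNReal.ofReal (∫ y, (1 + ‖x‖ ^ 2) ^ ((k : ℝ) - 1 / 2) * b y) := by
          rw [ofReal_integral_eq_lintegral_ofReal (hb.const_mul _)
            (Filter.Eventually.of_forall fun y => mul_nonneg hx0 (hb0 _))]
      _ ≤ _ := by
          rw [integral_const_mul, max_eq_right (by linarith)]
          apply ENNReal.ofReal_le_ofReal
          nlinarith
end
end

section
/- Let 0 < α < 1/4, 0 < λ₁ < 1 and A > 0. Suppose E : [0,∞) → ℂ is continuous with E(0) = 0, is supported in [0, λ₁], is continuously differentiable on (0,∞), and satisfies |E'(λ)| ≤ A λ^{-1/2} for all λ > 0 as well as |E'(b) − E'(λ)| ≤ A λ^{-1/2-α} (b−λ)^α whenever 0 < λ < b ≤ 3λ. Then there is a constant C (depending only on α and λ₁) such that for all t > 2, | ∫₀^∞ e^{itλ²} λ E(λ) dλ | ≤ C A t^{-1-α}. -/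
open MeasureTheory Set

noncomputable section

lemma aux_int_pow (s c : ℝ) (hs : -1 < s) (hc : 0 ≤ c) :
    IntegrableOn (fun x : ℝ => x ^ s) (Ioc 0 c) ∧
      ∫ x in Ioc (0:ℝ) c, x ^ s = c ^ (s + 1) / (s + 1) := by
  have h := intervalIntegral.intervalIntegrable_rpow' (a := 0) (b := c) hs
  refine ⟨(intervalIntegrable_iff_integrableOn_Ioc_of_le hc).1 h, ?_⟩
  rw [← intervalIntegral.integral_of_le hc, integral_rpow (Or.inl hs),
    Real.zero_rpow (by linarith), sub_zero]

lemma aux_pt_s12 (α A : ℝ) (hα : 0 < α) (hα4 : α < 1/4) (hA : 0 < A) (D : ℝ → ℂ)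
    (h1 : ∀ l : ℝ, 0 < l → ‖D l‖ ≤ A * l ^ (-(1/2) : ℝ))
    (h2 : ∀ l b : ℝ, 0 < l → l < b → b ≤ 3 * l →
        ‖D b - D l‖ ≤ A * l ^ (-(1/2) - α) * (b - l) ^ α) (h l b : ℝ) (hh : 0 < h)
    (hl : 0 < l) (hlb : l < b) (hb : b ^ 2 = l ^ 2 + h) (hhl : h ≤ l ^ 2) :
    ‖((1/2) * l⁻¹) • D l - ((1/2) * b⁻¹) • D b‖ ≤ A * h ^ α * l ^ (-(3/2) - 2 * α) := by
  have hb0 : 0 < b := hl.trans hlb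
  have hb3 : b ≤ 3 * l := by nlinarith
  have hd : b - l ≤ h / l := by
    rw [le_div_iff₀ hl]; nlinarith
  have e1 := h1 l hl
  have e2 := h2 l b hl hlb hb3
  have e3 : (b - l) ^ α ≤ (h / l) ^ α := Real.rpow_le_rpow (by linarith) hd hα.le
  have e4 : (h / l) ^ α = h ^ α * l ^ (-α) := by
    rw [Real.div_rpow hh.le hl.le, Real.rpow_neg hl.le]; rfl
  have hinv : b⁻¹ ≤ l⁻¹ := inv_anti₀ hl hlb.le
  have e5 : l⁻¹ - b⁻¹ ≤ l⁻¹ * (h ^ α * l ^ (-(2 * α))) := by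
    have : l⁻¹ - b⁻¹ ≤ l⁻¹ * (h / l ^ 2) := by
      have : l⁻¹ - b⁻¹ = l⁻¹ * ((b - l) / b) := by field_simp
      rw [this]
      refine mul_le_mul_of_nonneg_left ?_ (by positivity)
      rw [div_le_div_iff₀ hb0 (by positivity)]
      have : (b - l) * l ≤ h := by nlinarith
      nlinarith
    refine this.trans ?_
    gcongr
    have hx : h / l ^ 2 ≤ (h / l ^ 2) ^ α := by
      have : (h / l ^ 2) ^ (1:ℝ) ≤ (h / l ^ 2) ^ α :=
        Real.rpow_le_rpow_of_exponent_ge (by positivity)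
          ((div_le_one (by positivity)).2 hhl) (by linarith)
      simpa using this
    refine hx.trans (le_of_eq ?_)
    rw [Real.div_rpow hh.le (by positivity), Real.rpow_neg hl.le, Real.rpow_mul hl.le]
    norm_num
    rfl
  have p1 : l⁻¹ * l ^ (-(1/2) - α) * l ^ (-α) = l ^ (-(3/2) - 2 * α) := by
    rw [← Real.rpow_neg_one, ← Real.rpow_add hl, ← Real.rpow_add hl]; congr 1; ring
  have p2 : l⁻¹ * l ^ (-(1/2):ℝ) * l ^ (-(2 * α)) = l ^ (-(3/2) - 2 * α) := by
    rw [← Real.rpow_neg_one, ← Real.rpow_add hl, ← Real.rpow_add hl]; congr 1; ring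
  have key : ((1/2) * l⁻¹) • D l - ((1/2) * b⁻¹) • D b
      = ((1/2) * (l⁻¹ - b⁻¹)) • D l - ((1/2) * b⁻¹) • (D b - D l) := by
    module
  rw [key]
  refine (norm_sub_le _ _).trans ?_
  rw [norm_smul, norm_smul, Real.norm_of_nonneg (by linarith), Real.norm_of_nonneg (by positivity)]
  calc _ ≤ ((1/2) * (l⁻¹ * (h ^ α * l ^ (-(2 * α))))) * (A * l ^ (-(1/2) : ℝ))
        + ((1/2) * l⁻¹) * (A * l ^ (-(1/2) - α) * (h ^ α * l ^ (-α))) := by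
        rw [← e4]
        refine add_le_add ?_ ?_
        · gcongr
        · refine mul_le_mul (by linarith) (e2.trans ?_) (norm_nonneg _) (by positivity)
          gcongr
    _ = (1/2) * A * h ^ α * (l⁻¹ * l ^ (-(1/2):ℝ) * l ^ (-(2 * α)))
        + (1/2) * A * h ^ α * (l⁻¹ * l ^ (-(1/2) - α) * l ^ (-α)) := by ring
    _ = _ := by rw [p1, p2]; ring

lemma aux_shift (t : ℝ) (ht : 0 < t) (G : ℝ → ℂ) (hG : Integrable G) :
    2 * ‖∫ u : ℝ, Complex.exp (Complex.I * t * u) * G u‖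
      ≤ ∫ u : ℝ, ‖G u - G (u + Real.pi / t)‖ := by
  set h := Real.pi / t with hh
  have hn : ∀ u : ℝ, ‖Complex.exp (Complex.I * t * u)‖ = 1 := by
    intro u
    rw [show Complex.I * t * u = ((t * u : ℝ) : ℂ) * Complex.I by push_cast; ring]
    exact Complex.norm_exp_ofReal_mul_I _
  have hm : ∀ G : ℝ → ℂ, Integrable G →
      Integrable (fun u : ℝ => Complex.exp (Complex.I * t * u) * G u) := by
    intro G hG
    refine hG.bdd_mul (c := 1) (Continuous.aestronglyMeasurable (by fun_prop)) ?_
    exact Filter.Eventually.of_forall fun u => (hn u).le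
  have hG' : Integrable (fun u => G (u + h)) := hG.comp_add_right h
  have e1 : ∫ u : ℝ, Complex.exp (Complex.I * t * u) * G u
      = - ∫ u : ℝ, Complex.exp (Complex.I * t * u) * G (u + h) := by
    rw [← integral_add_right_eq_self _ h, ← integral_neg]
    congr 1
    ext u
    have : Complex.I * t * ((u + h : ℝ) : ℂ) = Complex.I * t * u + Real.pi * Complex.I := by
      have : (t:ℂ) ≠ 0 := by exact_mod_cast ht.ne'
      rw [hh]; push_cast; field_simp
    rw [this, Complex.exp_add, Complex.exp_pi_mul_I]; ring
  have e2 : 2 * ∫ u : ℝ, Complex.exp (Complex.I * t * u) * G u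
      = ∫ u : ℝ, Complex.exp (Complex.I * t * u) * (G u - G (u + h)) := by
    simp_rw [mul_sub]
    rw [integral_sub (hm _ hG) (hm _ hG'), two_mul]
    nth_rewrite 2 [e1]
    ring
  have e3 : 2 * ‖∫ u : ℝ, Complex.exp (Complex.I * t * u) * G u‖
      = ‖2 * ∫ u : ℝ, Complex.exp (Complex.I * t * u) * G u‖ := by simp
  rw [e3, e2]
  refine (norm_integral_le_integral_norm _).trans (le_of_eq ?_)
  congr 1; ext u
  rw [norm_mul, hn, one_mul]

/-- The estimate for the integral of the derivative. -/
lemma aux_D (α A : ℝ) (hα : 0 < α) (hα4 : α < 1/4) (hA : 0 < A) (D : ℝ → ℂ) (hDm : Measurable D)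
    (h0 : ∀ l : ℝ, 1 < l → D l = 0)
    (h1 : ∀ l : ℝ, 0 < l → ‖D l‖ ≤ A * l ^ (-(1/2) : ℝ))
    (h2 : ∀ l b : ℝ, 0 < l → l < b → b ≤ 3 * l →
        ‖D b - D l‖ ≤ A * l ^ (-(1/2) - α) * (b - l) ^ α) (t : ℝ) (ht : 2 < t) :
    ‖∫ l in Ioi (0:ℝ), Complex.exp (Complex.I * (t:ℂ) * (l:ℂ) ^ 2) * D l‖
      ≤ (4 * (2 * Real.pi) ^ (1/4 : ℝ) + Real.pi ^ α / (1/4 - α)) * A * t ^ (-α) := by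
  have ht0 : 0 < t := by linarith
  set h := Real.pi / t with hh
  have hh0 : 0 < h := by positivity
  set G : ℝ → ℂ := indicator (Ioi 0) (fun u => ((1/2) * (u ^ (1/2:ℝ))⁻¹) • D (u ^ (1/2:ℝ))) with hGdef
  have hGm : Measurable G := by
    refine Measurable.indicator ?_ measurableSet_Ioi
    have : Measurable (fun u : ℝ => u ^ (1/2:ℝ)) := by fun_prop
    exact (this.inv.const_mul _).smul (hDm.comp this)
  have hGneg : ∀ u, u ≤ 0 → G u = 0 := fun u hu => indicator_of_notMem (by simpa using hu) _
  have hGpos : ∀ u, 0 < u → G u = ((1/2) * (u ^ (1/2:ℝ))⁻¹) • D (u ^ (1/2:ℝ)) :=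
    fun u hu => indicator_of_mem (by simpa using hu) _
  have hGbig : ∀ u, 1 < u → G u = 0 := by
    intro u hu
    rw [hGpos u (by linarith), h0 _ (Real.one_lt_rpow hu (by norm_num)), smul_zero]
  have hGb : ∀ u, 0 < u → ‖G u‖ ≤ A / 2 * u ^ (-(3/4) : ℝ) := by
    intro u hu
    have hp : 0 < u ^ (1/2:ℝ) := by positivity
    rw [hGpos u hu, norm_smul, Real.norm_of_nonneg (by positivity)]
    calc _ ≤ (1/2) * (u ^ (1/2:ℝ))⁻¹ * (A * (u ^ (1/2:ℝ)) ^ (-(1/2) : ℝ)) := by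
          gcongr; exact h1 _ hp
      _ = A / 2 * ((u ^ (1/2:ℝ))⁻¹ * (u ^ (1/2:ℝ)) ^ (-(1/2) : ℝ)) := by ring
      _ = _ := by
          rw [← Real.rpow_neg hu.le, ← Real.rpow_mul hu.le, ← Real.rpow_add hu]; norm_num
  let P : ℝ → ℝ → ℝ := fun c => indicator (Ioc 0 c) (fun u => A / 2 * u ^ (-(3/4) : ℝ))
  have hPnn : ∀ c u, 0 ≤ P c u := by
    intro c u
    refine indicator_nonneg (fun u hu => ?_) u
    have := hu.1
    positivity
  have hPi : ∀ c, 0 ≤ c → Integrable (P c) := fun c hc =>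
    IntegrableOn.integrable_indicator ((aux_int_pow _ c (by norm_num) hc).1.const_mul _) measurableSet_Ioc
  have hPv : ∀ c, 0 ≤ c → ∫ u, P c u = 2 * A * c ^ (1/4:ℝ) := by
    intro c hc
    rw [integral_indicator measurableSet_Ioc, integral_const_mul,
      (aux_int_pow _ c (by norm_num) hc).2]
    norm_num; ring
  have hPmem : ∀ c u, u ≤ c → ‖G u‖ ≤ P c u := by
    intro c u hu
    rcases le_or_gt u 0 with h' | h'
    · rw [hGneg u h', norm_zero]; exact hPnn _ _
    · have : P c u = A / 2 * u ^ (-(3/4) : ℝ) := indicator_of_mem (show u ∈ Ioc 0 c from ⟨h', hu⟩) _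
      rw [this]; exact hGb u h'
  have hGi : Integrable G := by
    refine (hPi 1 zero_le_one).mono' hGm.aestronglyMeasurable (Filter.Eventually.of_forall fun u => ?_)
    rcases le_or_gt u 1 with h' | h'
    · exact hPmem 1 u h'
    · rw [hGbig u h', norm_zero]; exact hPnn _ _
  let Q : ℝ → ℝ := indicator (Ioc 0 1) (fun u => A * h ^ α * u ^ (-(3/4) - α : ℝ))
  have hQnn : ∀ u, 0 ≤ Q u := by
    intro u
    refine indicator_nonneg (fun u hu => ?_) u
    have := hu.1
    positivity
  have hQi : Integrable Q :=
    IntegrableOn.integrable_indicator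
      ((aux_int_pow _ 1 (by linarith) zero_le_one).1.const_mul _) measurableSet_Ioc
  have hQv : ∫ u, Q u = A * h ^ α / (1/4 - α) := by
    rw [integral_indicator measurableSet_Ioc, integral_const_mul,
      (aux_int_pow _ 1 (by linarith) zero_le_one).2, Real.one_rpow,
      show -(3/4) - α + 1 = 1/4 - α by ring]
    ring
  have hpt : ∀ u, ‖G u - G (u + h)‖ ≤ P (2 * h) u + P (2 * h) (u + h) + Q u := by
    intro u
    rcases le_or_gt u h with hu | hu
    · have a1 := hPmem (2 * h) u (by linarith)
      have a2 := hPmem (2 * h) (u + h) (by linarith)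
      have a3 := hQnn u
      have a4 := norm_sub_le (G u) (G (u + h))
      linarith
    · have hu0 : 0 < u := hh0.trans hu
      suffices H : ‖G u - G (u + h)‖ ≤ Q u by
        have a1 := hPnn (2 * h) u
        have a2 := hPnn (2 * h) (u + h)
        linarith
      rcases le_or_gt u 1 with h' | h'
      · have hq : Q u = A * h ^ α * u ^ (-(3/4) - α : ℝ) := indicator_of_mem (show u ∈ Ioc (0:ℝ) 1 from ⟨hu0, h'⟩) _
        have sq : ∀ x : ℝ, 0 < x → (x ^ (1/2:ℝ)) ^ 2 = x := by
          intro x hx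
          rw [← Real.sqrt_eq_rpow, Real.sq_sqrt hx.le]
        rw [hq, hGpos u hu0, hGpos _ (by linarith)]
        have := aux_pt_s12 α A hα hα4 hA D h1 h2 h (u ^ (1/2:ℝ)) ((u + h) ^ (1/2:ℝ)) hh0
          (by positivity) (Real.rpow_lt_rpow hu0.le (by linarith) (by norm_num))
          (by rw [sq _ hu0, sq _ (by linarith)]) (by rw [sq _ hu0]; exact hu.le)
        refine this.trans (le_of_eq ?_)
        rw [← Real.rpow_mul hu0.le]
        congr 2; ring
      · rw [hGbig u h', hGbig (u + h) (by linarith), sub_zero, norm_zero]; exact hQnn u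
  have hcv : ∫ l in Ioi (0:ℝ), Complex.exp (Complex.I * (t:ℂ) * (l:ℂ) ^ 2) * D l
      = ∫ u : ℝ, Complex.exp (Complex.I * t * u) * G u := by
    rw [← integral_comp_rpow_Ioi_of_pos (p := 1/2) (by norm_num)]
    have : (fun u : ℝ => Complex.exp (Complex.I * t * u) * G u)
      = indicator (Ioi 0) (fun u : ℝ => Complex.exp (Complex.I * t * u) *
          (((1/2) * (u ^ (1/2:ℝ))⁻¹) • D (u ^ (1/2:ℝ)))) := by
      ext u
      rcases le_or_gt u 0 with h' | h'
      · rw [hGneg u h', indicator_of_notMem (by simpa using h'), mul_zero]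
      · rw [hGpos u h', indicator_of_mem (by simpa using h')]
    rw [this, integral_indicator measurableSet_Ioi]
    refine setIntegral_congr_fun measurableSet_Ioi fun u hu => ?_
    have hu0 : 0 < u := hu
    have s1 : ((u ^ (1/2:ℝ) : ℝ) : ℂ) ^ 2 = u := by
      rw [← Complex.ofReal_pow, ← Real.sqrt_eq_rpow, Real.sq_sqrt hu0.le]
    have s2 : u ^ ((1/2:ℝ) - 1) = (u ^ (1/2:ℝ))⁻¹ := by
      rw [← Real.rpow_neg hu0.le]; norm_num
    simp only [s1, s2, mul_smul_comm]
  rw [hcv]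
  have hsh := aux_shift t ht0 G hGi
  rw [← hh] at hsh
  have i1 := hPi (2 * h) (by positivity)
  have i2 := i1.comp_add_right h
  have hle : ∫ u : ℝ, ‖G u - G (u + h)‖ ≤
      ∫ u, (P (2 * h) u + P (2 * h) (u + h) + Q u) :=
    integral_mono (hGi.sub (hGi.comp_add_right h)).norm ((i1.add i2).add hQi) hpt
  have hval : ∫ u, (P (2 * h) u + P (2 * h) (u + h) + Q u)
      = 4 * A * (2 * h) ^ (1/4:ℝ) + A * h ^ α / (1/4 - α) := by
    have q1 := integral_add (i1.add i2) hQi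
    have q2 := integral_add i1 i2
    simp only [Pi.add_apply] at q1
    rw [q1, q2, integral_add_right_eq_self (P (2*h)) h, hPv _ (by positivity), hQv]
    ring
  have b1 : (2 * h) ^ (1/4:ℝ) ≤ (2 * Real.pi) ^ (1/4:ℝ) * t ^ (-α) := by
    rw [hh, show 2 * (Real.pi / t) = (2 * Real.pi) / t by ring,
      Real.div_rpow (by positivity) ht0.le, div_eq_mul_inv, ← Real.rpow_neg ht0.le]
    gcongr
    · linarith
  have b2 : h ^ α = Real.pi ^ α * t ^ (-α) := by
    rw [hh, Real.div_rpow (by positivity) ht0.le, div_eq_mul_inv, ← Real.rpow_neg ht0.le]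
  have fin : 4 * A * (2 * h) ^ (1/4:ℝ) + A * h ^ α / (1/4 - α) ≤
      (4 * (2 * Real.pi) ^ (1/4 : ℝ) + Real.pi ^ α / (1/4 - α)) * A * t ^ (-α) := by
    rw [b2]
    have := mul_le_mul_of_nonneg_left b1 (by positivity : 0 ≤ 4 * A)
    calc _ ≤ _ := add_le_add_left this _
      _ = _ := by ring
  have nn := norm_nonneg (∫ u : ℝ, Complex.exp (Complex.I * t * u) * G u)
  linarith

/-- The abstract oscillatory integral estimate behind Lemma 4.5 and
Propositions 4.7 and 4.8 of the paper. -/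
theorem stmt12 (α lam₁ : ℝ) (hα : 0 < α) (hα4 : α < 1/4) (hlam : 0 < lam₁) (hlam1 : lam₁ < 1) :
    ∃ C : ℝ, 0 < C ∧ ∀ A : ℝ, 0 < A → ∀ E : ℝ → ℂ,
      ContinuousOn E (Ici 0) → E 0 = 0 →
      Function.support E ⊆ Icc 0 lam₁ →
      ContDiffOn ℝ 1 E (Ioi 0) →
      (∀ l : ℝ, 0 < l → ‖deriv E l‖ ≤ A * l ^ (-(1/2) : ℝ)) →
      (∀ l b : ℝ, 0 < l → l < b → b ≤ 3 * l →
        ‖deriv E b - deriv E l‖ ≤ A * l ^ (-(1/2) - α) * (b - l) ^ α) →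
      ∀ t : ℝ, 2 < t →
        ‖∫ l in Ioi (0:ℝ), Complex.exp (Complex.I * (t:ℂ) * (l:ℂ) ^ 2) * (l:ℂ) * E l‖
          ≤ C * A * t ^ (-1 - α) := by
  have hq : 0 < 1/4 - α := by linarith
  refine ⟨4 * (2 * Real.pi) ^ (1/4 : ℝ) + Real.pi ^ α / (1/4 - α), by positivity, ?_⟩
  intro A hA E hEc hE0 hEs hEd h1 h2 t ht
  have ht0 : 0 < t := by linarith
  have hEz : ∀ l, lam₁ < l → E l = 0 := by
    intro l hl
    by_contra hne
    exact absurd (hEs hne).2 (not_le.2 hl)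
  have hDz : ∀ l, 1 < l → deriv E l = 0 := by
    intro l hl
    have : E =ᶠ[nhds l] fun _ => 0 := by
      filter_upwards [Ioi_mem_nhds (hlam1.trans hl)] with x hx using hEz x hx
    rw [this.deriv_eq]; simp
  have hm : Measurable (deriv E) := measurable_deriv E
  have hD := aux_D α A hα hα4 hA (deriv E) hm hDz h1 h2 t ht
  have hDi : IntegrableOn (deriv E) (Ioi 0) := by
    have hI : Integrable (indicator (Ioc 0 1) (fun u : ℝ => A * u ^ (-(1/2) : ℝ))) :=
      IntegrableOn.integrable_indicator
        ((aux_int_pow _ 1 (by norm_num) zero_le_one).1.const_mul _) measurableSet_Ioc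
    refine (hI.integrableOn (s := Ioi 0)).mono' hm.aestronglyMeasurable ?_
    refine (ae_restrict_iff' measurableSet_Ioi).2 (Filter.Eventually.of_forall fun u hu => ?_)
    rcases le_or_gt u 1 with h' | h'
    · rw [indicator_of_mem (show u ∈ Ioc (0:ℝ) 1 from ⟨hu, h'⟩)]; exact h1 u hu
    · rw [hDz u h', norm_zero, indicator_of_notMem (fun h => absurd h.2 (not_le.2 h'))]
  have hn : ∀ u : ℝ, ‖Complex.exp (Complex.I * t * (u:ℂ) ^ 2)‖ = 1 := by
    intro u
    rw [show Complex.I * t * (u:ℂ) ^ 2 = ((t * u ^ 2 : ℝ) : ℂ) * Complex.I by push_cast; ring]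
    exact Complex.norm_exp_ofReal_mul_I _
  have hibp := integral_Ioi_mul_deriv_eq_deriv_mul (a := 0) (a' := 0) (b' := 0) (u := E)
    (u' := deriv E)
    (v := fun l : ℝ => Complex.exp (Complex.I * t * (l:ℂ) ^ 2))
    (v' := fun l : ℝ => Complex.exp (Complex.I * t * (l:ℂ) ^ 2) * (Complex.I * t * (2 * l)))
    (by
      intro x hx
      exact ((hEd.differentiableOn (by norm_num)).differentiableAt (Ioi_mem_nhds hx)).hasDerivAt)
    (by
      intro x hx
      have a1 : HasDerivAt (fun l : ℝ => (l:ℂ)) 1 x := Complex.ofRealCLM.hasDerivAt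
      have a2 := ((a1.fun_pow 2).const_mul (Complex.I * t)).cexp
      refine a2.congr_deriv ?_
      simp)
    (by
      have c : ContinuousOn (E * fun l : ℝ => Complex.exp (Complex.I * t * (l:ℂ) ^ 2) *
          (Complex.I * t * (2 * l))) (Icc 0 1) :=
        (hEc.mono Icc_subset_Ici_self).mul (Continuous.continuousOn (by fun_prop))
      have c' := (c.integrableOn_Icc (μ := volume)).mono_set Ioc_subset_Icc_self
      refine c'.of_forall_sdiff_eq_zero measurableSet_Ioi ?_
      intro x hx
      have : 1 < x := by
        by_contra hne
        exact hx.2 ⟨hx.1, not_lt.1 hne⟩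
      simp [hEz x (hlam1.trans this)])
    (by
      have : IntegrableOn (fun l : ℝ => Complex.exp (Complex.I * t * (l:ℂ) ^ 2) * deriv E l)
          (Ioi 0) :=
        Integrable.bdd_mul (c := 1) hDi (Continuous.aestronglyMeasurable (by fun_prop))
          (Filter.Eventually.of_forall fun u => (hn u).le)
      refine this.congr (Filter.Eventually.of_forall fun u => ?_)
      simp [mul_comm])
    (by
      have a1 : Filter.Tendsto E (nhdsWithin 0 (Ioi 0)) (nhds 0) := by
        have := (hEc 0 self_mem_Ici).mono_left (nhdsWithin_mono _ Ioi_subset_Ici_self)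
        rwa [hE0] at this
      have a2 : Filter.Tendsto (fun l : ℝ => Complex.exp (Complex.I * t * (l:ℂ) ^ 2))
          (nhdsWithin 0 (Ioi 0)) (nhds (Complex.exp (Complex.I * t * ((0:ℝ):ℂ) ^ 2))) :=
        (Continuous.tendsto (by fun_prop) 0).mono_left nhdsWithin_le_nhds
      have := a1.mul a2
      rwa [zero_mul] at this)
    (by
      refine Filter.Tendsto.congr' ?_ tendsto_const_nhds
      filter_upwards [Filter.eventually_gt_atTop lam₁] with x hx
      simp [hEz x hx])
  have e1 : ∫ x in Ioi (0:ℝ), E x * (Complex.exp (Complex.I * t * (x:ℂ) ^ 2) *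
        (Complex.I * t * (2 * x)))
      = (2 * Complex.I * t) *
        ∫ l in Ioi (0:ℝ), Complex.exp (Complex.I * (t:ℂ) * (l:ℂ) ^ 2) * (l:ℂ) * E l := by
    rw [← integral_const_mul]
    congr 1; ext x; ring
  have e2 : ∫ x in Ioi (0:ℝ), deriv E x * Complex.exp (Complex.I * t * (x:ℂ) ^ 2)
      = ∫ l in Ioi (0:ℝ), Complex.exp (Complex.I * (t:ℂ) * (l:ℂ) ^ 2) * deriv E l := by
    congr 1; ext x; ring
  rw [e1, e2] at hibp
  have hnorm := congrArg norm hibp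
  rw [norm_mul, sub_zero, zero_sub, norm_neg] at hnorm
  have h2t : ‖2 * Complex.I * (t:ℂ)‖ = 2 * t := by simp [abs_of_pos ht0]
  rw [h2t] at hnorm
  rw [← hnorm] at hD
  have et : t ^ (-1 - α) = t⁻¹ * t ^ (-α) := by
    rw [← Real.rpow_neg_one, ← Real.rpow_add ht0]; congr 1
  rw [et]
  set X := ‖∫ l in Ioi (0:ℝ), Complex.exp (Complex.I * (t:ℂ) * (l:ℂ) ^ 2) * (l:ℂ) * E l‖ with hX
  have hX0 : 0 ≤ X := norm_nonneg _
  have hD' : X * t ≤ (4 * (2 * Real.pi) ^ (1/4 : ℝ) + Real.pi ^ α / (1/4 - α)) * A * t ^ (-α) := by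
    nlinarith
  have := (le_div_iff₀ ht0).2 hD'
  refine this.trans (le_of_eq ?_)
  ring
end
end

section
/- Let A > 0 and let E : [0,∞) → ℂ be continuous with E(0) = 0, supported in [0,1], twice continuously differentiable on (0,1), and satisfy |E'(λ)| ≤ A λ^{-1/2} and |(E'(λ)/λ)'| ≤ A λ^{-5/2} for all 0 < λ < 1. Then there is an absolute constant C such that for all t > 2, | ∫₀^∞ e^{itλ²} λ E(λ) dλ | ≤ C A t^{-5/4}. -/
open MeasureTheory Set

noncomputable section

def phs (t : ℝ) (l : ℝ) : ℂ := Complex.exp (Complex.I * (t:ℂ) * (l:ℂ) ^ 2)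

lemma phs_norm (t l : ℝ) : ‖phs t l‖ = 1 := by
  have h : Complex.I * (t:ℂ) * (l:ℂ) ^ 2 = ((t * l ^ 2 : ℝ) : ℂ) * Complex.I := by
    push_cast; ring
  rw [phs, h, Complex.norm_exp_ofReal_mul_I]

lemma phs_cont (t : ℝ) : Continuous (phs t) := by
  unfold phs; fun_prop

lemma phs_deriv (t l : ℝ) :
    HasDerivAt (phs t) (2 * Complex.I * t * l * phs t l) l := by
  have h1 : HasDerivAt (fun s : ℝ => (s : ℂ)) 1 l := Complex.ofRealCLM.hasDerivAt
  have h3 : HasDerivAt (fun s : ℝ => (s : ℂ) ^ 2) (2 * l) l :=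
    (h1.pow 2).congr_deriv (by simp)
  have h2 := (h3.const_mul (Complex.I * (t:ℂ))).cexp
  unfold phs
  exact h2.congr_deriv (by ring)

lemma bnd (t A p a b : ℝ) (hab : a ≤ b) (g : ℝ → ℂ)
    (hg : Measurable g)
    (hb : ∀ l ∈ Ioo a b, ‖g l‖ ≤ A * l ^ p)
    (hp : IntervalIntegrable (fun l : ℝ => l ^ p) volume a b) :
    IntervalIntegrable (fun l => phs t l * g l) volume a b ∧
      ‖∫ l in a..b, phs t l * g l‖ ≤ A * ∫ l in a..b, l ^ p := by
  have hae : ∀ᵐ l ∂(volume.restrict (Ioc a b)), ‖phs t l * g l‖ ≤ A * l ^ p := by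
    rw [← restrict_Ioo_eq_restrict_Ioc]
    filter_upwards [ae_restrict_mem measurableSet_Ioo] with l hl
    rw [norm_mul, phs_norm, one_mul]
    exact hb l hl
  constructor
  · rw [intervalIntegrable_iff_integrableOn_Ioc_of_le hab]
    have := (intervalIntegrable_iff_integrableOn_Ioc_of_le hab).1 (hp.const_mul A)
    refine Integrable.mono' this ?_ hae
    exact (((phs_cont t).measurable).mul hg).aestronglyMeasurable
  · rw [← intervalIntegral.integral_const_mul]
    refine intervalIntegral.norm_integral_le_of_norm_le hab ?_ (hp.const_mul A)
    exact (ae_restrict_iff' measurableSet_Ioc).1 hae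

lemma ibp_s15 (t a b : ℝ) (hab : a ≤ b) (Q : ℝ → ℂ) (hc : ContinuousOn Q (Icc a b))
    (hd : ∀ l ∈ Ioo a b, DifferentiableAt ℝ Q l)
    (hi : IntervalIntegrable (fun l => phs t l * deriv Q l) volume a b) :
    2 * Complex.I * t * (∫ l in a..b, phs t l * l * Q l)
      = phs t b * Q b - phs t a * Q a - ∫ l in a..b, phs t l * deriv Q l := by
  have hi2 : IntervalIntegrable (fun l => 2 * Complex.I * t * (phs t l * l * Q l)) volume a b := by
    apply ContinuousOn.intervalIntegrable
    rw [uIcc_of_le hab]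
    have := (phs_cont t)
    fun_prop
  have := intervalIntegral.integral_eq_sub_of_hasDerivAt_of_le hab
    (f := fun l => phs t l * Q l)
    (f' := fun l => 2 * Complex.I * t * (phs t l * l * Q l) + phs t l * deriv Q l)
    ((phs_cont t).continuousOn.mul hc) ?_ (hi2.add hi)
  · rw [intervalIntegral.integral_add hi2 hi, intervalIntegral.integral_const_mul] at this
    linear_combination this
  · intro l hl
    exact ((phs_deriv t l).mul (hd l hl).hasDerivAt).congr_deriv (by ring)

/-- The abstract error estimate from the proof of Proposition 4.3 of the paper. -/
theorem stmt15 :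
    ∃ C : ℝ, 0 < C ∧ ∀ A : ℝ, 0 < A → ∀ E : ℝ → ℂ,
      ContinuousOn E (Ici 0) → E 0 = 0 →
      Function.support E ⊆ Icc 0 1 →
      ContDiffOn ℝ 2 E (Ioo 0 1) →
      (∀ l : ℝ, 0 < l → l < 1 → ‖deriv E l‖ ≤ A * l ^ (-(1/2) : ℝ)) →
      (∀ l : ℝ, 0 < l → l < 1 →
        ‖deriv (fun s : ℝ => deriv E s / (s:ℂ)) l‖ ≤ A * l ^ ((-5 : ℝ)/2)) →
      ∀ t : ℝ, 2 < t →
        ‖∫ l in Ioi (0:ℝ), Complex.exp (Complex.I * (t:ℂ) * (l:ℂ) ^ 2) * (l:ℂ) * E l‖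
          ≤ C * A * t ^ ((-5 : ℝ)/4) := by
  refine ⟨3, by norm_num, ?_⟩
  intro A hA E hEc hE0 hEs hE2 h1 h2 t ht
  have hz : ∀ l, 1 < l → E l = 0 := by
    intro l hl
    by_contra h
    exact absurd (hEs h).2 (not_le.2 hl)
  have hE1 : E 1 = 0 := by
    have hc : Filter.Tendsto E (nhdsWithin 1 (Ioi 1)) (nhds (E 1)) :=
      (hEc 1 (by simp)).mono_left (nhdsWithin_mono _ (fun x hx => by
        simp only [mem_Ioi, mem_Ici] at *; linarith))
    refine tendsto_nhds_unique hc (tendsto_const_nhds.congr' ?_)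
    filter_upwards [self_mem_nhdsWithin] with x hx
    exact (hz x hx).symm
  have hint : (∫ l in Ioi (0:ℝ), Complex.exp (Complex.I * (t:ℂ) * (l:ℂ) ^ 2) * (l:ℂ) * E l)
      = ∫ l in (0:ℝ)..1, phs t l * l * E l := by
    rw [intervalIntegral.integral_of_le zero_le_one]
    change (∫ l in Ioi (0:ℝ), phs t l * l * E l) = _
    apply setIntegral_eq_of_subset_of_forall_sdiff_eq_zero measurableSet_Ioi
    · exact fun x hx => hx.1
    · intro x hx
      have : 1 < x := by
        by_contra h
        exact hx.2 ⟨hx.1, not_lt.1 h⟩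
      simp [hz x this]
  rw [hint]
  have hEd : ∀ l ∈ Ioo (0:ℝ) 1, DifferentiableAt ℝ E l := fun l hl =>
    (hE2.differentiableOn (by norm_num)).differentiableAt (isOpen_Ioo.mem_nhds hl)
  have hGd : ∀ l ∈ Ioo (0:ℝ) 1, DifferentiableAt ℝ (fun s : ℝ => deriv E s / (s:ℂ)) l := by
    intro l hl
    have hd : DifferentiableAt ℝ (deriv E) l :=
      ((hE2.deriv_of_isOpen (m := 1) isOpen_Ioo (by norm_num)).differentiableOn
        (by norm_num)).differentiableAt (isOpen_Ioo.mem_nhds hl)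
    have ho : DifferentiableAt ℝ (fun s : ℝ => (s : ℂ)) l :=
      Complex.ofRealCLM.differentiableAt
    exact hd.div ho (by exact_mod_cast hl.1.ne')
  have hmE : Measurable (deriv E) := measurable_deriv E
  have hp0 : ∀ a b : ℝ, IntervalIntegrable (fun l : ℝ => l ^ (-(1/2) : ℝ)) volume a b := fun a b =>
    intervalIntegral.intervalIntegrable_rpow' (by norm_num)
  have b01 := bnd t A _ 0 1 zero_le_one (deriv E) hmE (fun l hl => h1 l hl.1 hl.2) (hp0 0 1)
  have i1 := ibp_s15 t 0 1 zero_le_one E (hEc.mono (fun x hx => hx.1)) hEd b01.1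
  rw [hE0, hE1] at i1
  simp only [mul_zero, sub_zero, zero_sub] at i1
  have ht0 : 0 < t := by linarith
  -- parameters
  set r : ℝ := t ^ (-(1/4) : ℝ) with hr
  have hr0 : 0 < r := Real.rpow_pos_of_pos ht0 _
  have hr4 : r ^ 4 * t = 1 := by
    rw [hr, ← Real.rpow_natCast, ← Real.rpow_mul ht0.le]
    norm_num [Real.rpow_neg_one]
    exact inv_mul_cancel₀ ht0.ne'
  have hrt : t ^ ((-5 : ℝ)/4) = r / t := by
    rw [hr, ← Real.rpow_sub_one ht0.ne']; norm_num
  have hr4' : r ^ 4 < 1/2 := by nlinarith [pow_pos hr0 4]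
  obtain ⟨a, ha⟩ : ∃ a, a = r ^ 2 := ⟨_, rfl⟩
  have ha0 : 0 < a := by rw [ha]; positivity
  have haa : a ^ 2 < 1/2 := by rw [ha]; nlinarith
  have ha1 : a < 3/4 := by nlinarith
  obtain ⟨b, hb⟩ : ∃ b, b = 1 - a / 4 := ⟨_, rfl⟩
  have hab : a < b := by linarith
  have hb1 : b < 1 := by linarith
  have hb0 : 1/2 < b := by linarith
  have hr1 : r < 1 := by nlinarith
  have hsub : Icc a b ⊆ Ioo (0:ℝ) 1 := fun x hx => ⟨by linarith [hx.1], by linarith [hx.2]⟩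
  -- rpow facts
  have hahalf : a ^ ((1/2 : ℝ)) = r := by
    rw [ha, ← Real.sqrt_eq_rpow, Real.sqrt_sq hr0.le]
  have ha32 : a ^ (-(3/2) : ℝ) = (r ^ 3)⁻¹ := by
    rw [Real.rpow_neg ha0.le, show (3/2 : ℝ) = (1/2) * (3:ℕ) by norm_num, Real.rpow_mul ha0.le,
      hahalf, Real.rpow_natCast]
  -- pieces
  have p1 := bnd t A _ 0 a ha0.le (deriv E) hmE
    (fun l hl => h1 l hl.1 (by linarith [hl.2])) (hp0 0 a)
  have p2 := bnd t A _ a b hab.le (deriv E) hmE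
    (fun l hl => h1 l (by linarith [hl.1]) (by linarith [hl.2])) (hp0 a b)
  have p3 := bnd t A _ b 1 hb1.le (deriv E) hmE
    (fun l hl => h1 l (by linarith [hl.1]) (by linarith [hl.2])) (hp0 b 1)
  have n1 : ‖∫ l in (0:ℝ)..a, phs t l * deriv E l‖ ≤ 2 * A * r := by
    refine p1.2.trans (le_of_eq ?_)
    rw [integral_rpow (Or.inl (by norm_num))]
    norm_num [hahalf]
    ring
  have n3 : ‖∫ l in b..1, phs t l * deriv E l‖ ≤ A * r := by
    have := intervalIntegral.norm_integral_le_of_norm_le_const_ae (a := b) (b := 1) (C := 2 * A)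
      (f := fun l => phs t l * deriv E l) ?_
    · refine this.trans ?_
      rw [abs_of_pos (by linarith)]
      nlinarith [mul_pos hA hr0]
    · have : ∀ᵐ l : ℝ, l ≠ 1 := by
        simp [ae_iff]
      filter_upwards [this] with l hl hm
      rw [uIoc_of_le hb1.le] at hm
      rw [norm_mul, phs_norm, one_mul]
      have hl0 : 1/2 < l := by linarith [hm.1]
      refine (h1 l (by linarith) (lt_of_le_of_ne hm.2 hl)).trans ?_
      have : l ^ (-(1/2) : ℝ) ≤ 2 := by
        calc l ^ (-(1/2) : ℝ) ≤ (1/2 : ℝ) ^ (-(1/2) : ℝ) :=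
              Real.rpow_le_rpow_of_nonpos (by norm_num) hl0.le (by norm_num)
          _ ≤ (1/2 : ℝ) ^ (-1 : ℝ) :=
              Real.rpow_le_rpow_of_exponent_ge (by norm_num) (by norm_num) (by norm_num)
          _ = 2 := by rw [Real.rpow_neg_one]; norm_num
      nlinarith
  have hGn : ∀ l ∈ Icc a b, ‖phs t l * (deriv E l / (l:ℂ))‖ ≤ A * (r ^ 3)⁻¹ := by
    intro l hl
    have hl' := hsub hl
    rw [norm_mul, phs_norm, one_mul, norm_div, Complex.norm_real, Real.norm_of_nonneg hl'.1.le,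
      ← ha32]
    calc ‖deriv E l‖ / l ≤ A * l ^ (-(1/2) : ℝ) / l := by
          have := h1 l hl'.1 hl'.2
          have := hl'.1
          gcongr
      _ = A * l ^ (-(3/2) : ℝ) := by
          rw [mul_div_assoc, ← Real.rpow_sub_one hl'.1.ne']; norm_num
      _ ≤ _ := by
          have := Real.rpow_le_rpow_of_nonpos ha0 hl.1 (show (-(3/2) : ℝ) ≤ 0 by norm_num)
          gcongr
  have h0n : (0:ℝ) ∉ uIcc a b := by
    rw [uIcc_of_le hab.le]; exact fun h => by linarith [h.1]
  have q := bnd t A ((-5)/2) a b hab.le (deriv (fun s : ℝ => deriv E s / (s:ℂ)))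
    (measurable_deriv _) (fun l hl => h2 l (by linarith [hl.1]) (by linarith [hl.2]))
    (intervalIntegral.intervalIntegrable_rpow (Or.inr h0n))
  have qn : ‖∫ l in a..b, phs t l * deriv (fun s : ℝ => deriv E s / (s:ℂ)) l‖
      ≤ A * (r ^ 3)⁻¹ := by
    refine q.2.trans ?_
    rw [integral_rpow (Or.inr ⟨by norm_num, h0n⟩)]
    gcongr
    rw [show ((-5:ℝ)/2 + 1) = -(3/2) by norm_num, ha32]
    have h3 : 0 ≤ b ^ (-(3/2) : ℝ) := Real.rpow_nonneg (by linarith) _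
    have h4 : 0 < (r ^ 3)⁻¹ := by positivity
    linarith
  have i2 := ibp_s15 t a b hab.le (fun s : ℝ => deriv E s / (s:ℂ))
    (fun l hl => (hGd l (hsub hl)).continuousAt.continuousWithinAt)
    (fun l hl => hGd l (hsub (Ioo_subset_Icc_self hl))) q.1
  have hcong : (∫ l in a..b, phs t l * l * (deriv E l / (l:ℂ)))
      = ∫ l in a..b, phs t l * deriv E l := by
    apply intervalIntegral.integral_congr
    intro l hl
    rw [uIcc_of_le hab.le] at hl
    have : (l:ℂ) ≠ 0 := by exact_mod_cast (hsub hl).1.ne'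
    simp only
    field_simp
  rw [hcong] at i2
  have hnorm : ∀ z : ℂ, ‖2 * Complex.I * t * z‖ = 2 * t * ‖z‖ := by
    intro z
    simp [abs_of_pos ht0]
  have n2 : ‖∫ l in a..b, phs t l * deriv E l‖ ≤ 3/2 * A * r := by
    have h3 := hnorm (∫ l in a..b, phs t l * deriv E l)
    rw [i2] at h3
    have h4 := hGn b ⟨hab.le, le_rfl⟩
    have h5 := hGn a ⟨le_rfl, hab.le⟩
    have h6 : 2 * t * ‖∫ l in a..b, phs t l * deriv E l‖ ≤ 3 * (A * (r ^ 3)⁻¹) := by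
      rw [← h3]
      refine (norm_sub_le _ _).trans ?_
      have := norm_sub_le (phs t b * (deriv E b / (b:ℂ))) (phs t a * (deriv E a / (a:ℂ)))
      linarith
    have h7 : (r ^ 3)⁻¹ = r * t := by
      refine inv_eq_of_mul_eq_one_right ?_
      linarith [hr4, show r ^ 3 * (r * t) = r ^ 4 * t by ring]
    rw [h7] at h6
    have : 2 * t * ‖∫ l in a..b, phs t l * deriv E l‖ ≤ 2 * t * (3/2 * A * r) := by
      linarith
    exact le_of_mul_le_mul_left this (by positivity)
  have hsplit : (∫ l in (0:ℝ)..1, phs t l * deriv E l) =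
      (∫ l in (0:ℝ)..a, phs t l * deriv E l) + (∫ l in a..b, phs t l * deriv E l)
        + ∫ l in b..1, phs t l * deriv E l := by
    rw [intervalIntegral.integral_add_adjacent_intervals p1.1 p2.1,
      intervalIntegral.integral_add_adjacent_intervals (p1.1.trans p2.1) p3.1]
  have hfin := hnorm (∫ l in (0:ℝ)..1, phs t l * l * E l)
  rw [i1, norm_neg, hsplit] at hfin
  have h8 := norm_add₃_le (a := ∫ l in (0:ℝ)..a, phs t l * deriv E l)
    (b := ∫ l in a..b, phs t l * deriv E l) (c := ∫ l in b..1, phs t l * deriv E l)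
  rw [hrt, mul_div_assoc', le_div_iff₀ ht0]
  nlinarith [mul_pos hA hr0]
end
end
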